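/- arXiv:2512.12096 — 5 statements merged into one kernel-verified Lean document; each statement's English description precedes it below -/
import Mathlib

section
/- Let R be an associative ring with identity and let X be an object of D(R). Then the following are equivalent: (1) X is ξ-Gprojective, i.e., there are objects X_t of D(R) for t ∈ ℤ with X_0 ≅ X and, for each t, a cohomologically ghost distinguished triangle X_{t+1} → P_t → X_t → X_{t+1}⟦1⟧ with P_t ∈ ⟨P⟩₁ such that for every P ∈ ⟨P⟩₁ the induced sequence 0 → Hom_{D(R)}(X_t,P) → Hom_{D(R)}(P_t,P) → Hom_{D(R)}(X_{t+1},P) → 0 of abelian groups is exact; (2) for every s ∈ ℤ the module H^{-s}(X) is Gorenstein projective, and for every module B ∈ GP^⊥ and every s ∈ ℤ the canonical map γ_s : Hom_{D(R)}(X, S(B)⟦s⟧) → Hom_R(H^{-s}(X), B) is bijective. (Proposition 3.2.) -/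
open CategoryTheory Limits DerivedCategory Pretriangulated

noncomputable section

universe w u

variable {R : Type u} [Ring R]

def Ext1Zero [HasExt.{w} (ModuleCat.{u} R)] (A B : ModuleCat.{u} R) : Prop :=
  Subsingleton (Abelian.Ext A B 1)

variable [HasDerivedCategory.{w} (ModuleCat.{u} R)]

def GhostTriangle {X Y Z : DerivedCategory (ModuleCat.{u} R)}
    (f : X ⟶ Y) (g : Y ⟶ Z) (h : Z ⟶ X⟦(1:ℤ)⟧) : Prop :=
  (Triangle.mk f g h ∈ distTriang (DerivedCategory (ModuleCat.{u} R))) ∧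
  ∀ s : ℤ,
    Function.Injective ((homologyFunctor (ModuleCat.{u} R) s).map f) ∧
    Function.Surjective ((homologyFunctor (ModuleCat.{u} R) s).map g) ∧
    Function.Exact ((homologyFunctor (ModuleCat.{u} R) s).map f)
      ((homologyFunctor (ModuleCat.{u} R) s).map g)

def stalk (M : ModuleCat.{u} R) : DerivedCategory (ModuleCat.{u} R) :=
  DerivedCategory.Q.obj
    ((HomologicalComplex.single (ModuleCat.{u} R) (ComplexShape.up ℤ) 0).obj M)

def stalkHomologyIso (M : ModuleCat.{u} R) :
    (homologyFunctor (ModuleCat.{u} R) 0).obj (stalk M) ≅ M :=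
  (homologyFunctorFactors (ModuleCat.{u} R) 0).app _ ≪≫
    (HomologicalComplex.homologyFunctorSingleIso (ModuleCat.{u} R) (ComplexShape.up ℤ) 0).app M

def shiftHomologyIso (X : DerivedCategory (ModuleCat.{u} R)) (s a a' : ℤ) (h : s + a = a') :
    (homologyFunctor (ModuleCat.{u} R) a).obj (X⟦s⟧) ≅
      (homologyFunctor (ModuleCat.{u} R) a').obj X :=
  ((homologyFunctor (ModuleCat.{u} R) 0).shiftIso s a a' h).app X

def gammaMap (X : DerivedCategory (ModuleCat.{u} R)) (M : ModuleCat.{u} R) (s : ℤ)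
    (f : X ⟶ (stalk M)⟦s⟧) : (homologyFunctor (ModuleCat.{u} R) (-s)).obj X ⟶ M :=
  (homologyFunctor (ModuleCat.{u} R) (-s)).map f ≫
    (shiftHomologyIso (stalk M) s (-s) 0 (by ring)).hom ≫ (stalkHomologyIso M).hom

def stalkCoproduct (J : Type u) (P : J → ModuleCat.{u} R) (n : J → ℤ) :
    DerivedCategory (ModuleCat.{u} R) :=
  DerivedCategory.Q.obj
    (∐ fun j => (((HomologicalComplex.single (ModuleCat.{u} R) (ComplexShape.up ℤ) 0).obj
      (P j))⟦n j⟧))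

def memP1 (E : DerivedCategory (ModuleCat.{u} R)) : Prop :=
  ∃ (J : Type u) (P : J → ModuleCat.{u} R) (n : J → ℤ),
    (∀ j, Projective (P j)) ∧
    ∃ (i : E ⟶ stalkCoproduct J P n) (r : stalkCoproduct J P n ⟶ E), i ≫ r = 𝟙 E

def IsGorensteinProjective (G : ModuleCat.{u} R) : Prop :=
  ∃ P : CochainComplex (ModuleCat.{u} R) ℤ,
    (∀ n : ℤ, Projective (P.X n)) ∧ (∀ n : ℤ, P.ExactAt n) ∧
    Nonempty (G ≅ P.cycles 0) ∧
    ∀ (Q : ModuleCat.{u} R), Projective Q → ∀ (n : ℤ) (f : P.X n ⟶ Q),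
      P.d (n-1) n ≫ f = 0 → ∃ g : P.X (n+1) ⟶ Q, f = P.d n (n+1) ≫ g

section GorensteinProjective

variable {A : Type u} [Ring A]

/-- A relation that can be continued in both directions admits a bi-infinite chain through any
given point. -/
lemma exists_int_chain {α : Type*} (r : α → α → Prop) (hl : ∀ y, ∃ x, r x y)
    (hr : ∀ x, ∃ y, r x y) (x₀ : α) :
    ∃ s : ℤ → α, s 0 = x₀ ∧ ∀ t, r (s t) (s (t + 1)) := by
  choose L hL using hl
  choose N hN using hr
  refine ⟨fun t => match t with
    | Int.ofNat n => N^[n] x₀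
    | Int.negSucc n => L^[n + 1] x₀, rfl, fun t => ?_⟩
  match t with
  | Int.ofNat n =>
    change r (N^[n] x₀) (N^[n + 1] x₀)
    rw [Function.iterate_succ_apply']
    exact hN _
  | Int.negSucc 0 => exact hL x₀
  | Int.negSucc (n + 1) =>
    change r (L^[n + 1 + 1] x₀) (L^[n + 1] x₀)
    rw [Function.iterate_succ_apply' L (n + 1)]
    exact hL _

/-- `GPStep M N`: there is a short exact sequence `0 → M → P → N → 0` with `P` projective which
stays exact after applying `Hom(-, Q)` for all projective modules `Q`. -/
def GPStep (M N : ModuleCat.{u} A) : Prop :=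
  ∃ S : ShortComplex (ModuleCat.{u} A), S.X₁ = M ∧ S.X₃ = N ∧ S.ShortExact ∧ Projective S.X₂ ∧
    ∀ (Q : ModuleCat.{u} A), Projective Q → ∀ a : S.X₁ ⟶ Q, ∃ b : S.X₂ ⟶ Q, S.f ≫ b = a

lemma GPStep.mk {M P N : ModuleCat.{u} A} (f : M ⟶ P) (g : P ⟶ N) (w : f ≫ g = 0)
    (hS : (ShortComplex.mk f g w).ShortExact) (hP : Projective P)
    (h : ∀ (Q : ModuleCat.{u} A), Projective Q → ∀ a : M ⟶ Q, ∃ b : P ⟶ Q, f ≫ b = a) :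
    GPStep M N :=
  ⟨ShortComplex.mk f g w, rfl, rfl, hS, hP, h⟩

lemma GPStep.exists {M N : ModuleCat.{u} A} (h : GPStep M N) :
    ∃ (P : ModuleCat.{u} A) (f : M ⟶ P) (g : P ⟶ N) (w : f ≫ g = 0),
      (ShortComplex.mk f g w).ShortExact ∧ Projective P ∧
      ∀ (Q : ModuleCat.{u} A), Projective Q → ∀ a : M ⟶ Q, ∃ b : P ⟶ Q, f ≫ b = a := by
  obtain ⟨S, rfl, rfl, hS, hP, h⟩ := h
  exact ⟨S.X₂, S.f, S.g, S.zero, hS, hP, h⟩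

lemma IsGorensteinProjective.of_iso {M N : ModuleCat.{u} A} (e : M ≅ N)
    (h : IsGorensteinProjective M) : IsGorensteinProjective N := by
  obtain ⟨P, h₁, h₂, ⟨i⟩, h₃⟩ := h
  exact ⟨P, h₁, h₂, ⟨e.symm ≪≫ i⟩, h₃⟩

lemma isGorensteinProjective_of_chain (G : ℤ → ModuleCat.{u} A)
    (hG : ∀ t, GPStep (G t) (G (t + 1))) : IsGorensteinProjective (G 0) := by
  choose P f g w hS hP hQ using fun t => (hG t).exists
  have hm : ∀ t, Mono (f t) := fun t => (hS t).mono_f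
  have he : ∀ t, Epi (g t) := fun t => (hS t).epi_g
  let K : CochainComplex (ModuleCat.{u} A) ℤ :=
    CochainComplex.of P (fun t => g t ≫ f (t + 1)) (fun t => by
      simp [reassoc_of% (w (t + 1))])
  have hd : ∀ t, K.d t (t + 1) = g t ≫ f (t + 1) := fun t => by
    simp [K]
  refine ⟨K, hP, fun n => ?_, ⟨?_⟩, fun Q hQ' n a ha => ?_⟩
  · obtain ⟨m, rfl⟩ : ∃ m, n = m + 1 := ⟨n - 1, by ring⟩
    rw [HomologicalComplex.exactAt_iff' K m (m + 1) (m + 1 + 1) (by simp) (by simp)]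
    let S' : ShortComplex (ModuleCat.{u} A) := ShortComplex.mk (K.d m (m + 1)) (g (m + 1))
      (by rw [hd, Category.assoc, w, comp_zero])
    have hS' : S'.Exact := by
      let φ : S' ⟶ ShortComplex.mk _ _ (w (m + 1)) :=
        { τ₁ := g m
          τ₂ := 𝟙 _
          τ₃ := 𝟙 _
          comm₁₂ := by simp [S', hd] }
      have : Epi φ.τ₁ := he m
      have : IsIso φ.τ₂ := by dsimp [φ]; infer_instance
      have : Mono φ.τ₃ := by dsimp [φ]; infer_instance
      exact (ShortComplex.exact_iff_of_epi_of_isIso_of_mono φ).2 (hS (m + 1)).exact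
    let φ : S' ⟶ K.sc' m (m + 1) (m + 1 + 1) :=
      { τ₁ := 𝟙 (K.X m)
        τ₂ := 𝟙 (K.X (m + 1))
        τ₃ := f (m + 1 + 1)
        comm₂₃ := (Category.id_comp (K.d (m + 1) (m + 1 + 1))).trans (hd (m + 1)) }
    have : Epi φ.τ₁ := inferInstanceAs (Epi (𝟙 (K.X m)))
    have : IsIso φ.τ₂ := inferInstanceAs (IsIso (𝟙 (K.X (m + 1))))
    have : Mono φ.τ₃ := hm _
    exact (ShortComplex.exact_iff_of_epi_of_isIso_of_mono φ).1 hS'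
  · have hz : f 0 ≫ K.d 0 (0 + 1) = 0 := by rw [hd, reassoc_of% (w 0), zero_comp]
    have hk := isKernelCompMono (hS 0).fIsKernel (f (0 + 1)) (hd 0)
    exact IsLimit.conePointUniqueUpToIso hk (K.cyclesIsKernel 0 (0 + 1) (by simp))
  · obtain ⟨m, rfl⟩ : ∃ m, n = m + 1 := ⟨n - 1, by ring⟩
    have h1 : f (m + 1) ≫ a = 0 := by
      rw [show (m + 1 - 1 : ℤ) = m by ring, hd, Category.assoc] at ha
      rw [← cancel_epi (g m), ha, comp_zero]
    obtain ⟨c, hc⟩ : ∃ c : G (m + 1 + 1) ⟶ Q, g (m + 1) ≫ c = a :=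
      ⟨(hS (m + 1)).exact.desc a h1, (hS (m + 1)).exact.g_desc a h1⟩
    obtain ⟨b, hb⟩ := hQ (m + 1 + 1) Q hQ' c
    exact ⟨b, by rw [hd, Category.assoc, hb, hc]⟩

/-- A class of modules in which `GPStep` can be continued in both directions consists of
Gorenstein projective modules. -/
lemma isGorensteinProjective_of_closed (𝒢 : ModuleCat.{u} A → Prop)
    (hl : ∀ N, 𝒢 N → ∃ M, 𝒢 M ∧ GPStep M N) (hr : ∀ M, 𝒢 M → ∃ N, 𝒢 N ∧ GPStep M N)
    {G : ModuleCat.{u} A} (hG : 𝒢 G) : IsGorensteinProjective G := by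
  obtain ⟨s, h0, hs⟩ := exists_int_chain (α := { M // 𝒢 M }) (fun M N => GPStep M.1 N.1)
    (fun N => by
      obtain ⟨M, hM, h⟩ := hl N.1 N.2
      exact ⟨⟨M, hM⟩, h⟩)
    (fun M => by
      obtain ⟨N, hN, h⟩ := hr M.1 M.2
      exact ⟨⟨N, hN⟩, h⟩) ⟨G, hG⟩
  have := isGorensteinProjective_of_chain (fun t => (s t).1) hs
  rwa [h0] at this

lemma isGorensteinProjective_of_projective {P : ModuleCat.{u} A} (hP : Projective P) :
    IsGorensteinProjective P := by
  have h : ∀ P : ModuleCat.{u} A, Projective P → GPStep P P := fun P hP =>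
    GPStep.mk (biprod.inl : P ⟶ P ⊞ P) biprod.snd (by simp)
      { exact := (ShortComplex.Splitting.ofHasBinaryBiproduct P P).exact
        mono_f := by dsimp; infer_instance
        epi_g := by dsimp; infer_instance } inferInstance
      (fun Q _ a => ⟨biprod.fst ≫ a, by simp⟩)
  exact isGorensteinProjective_of_closed (fun M => Projective M) (fun N hN => ⟨N, hN, h N hN⟩)
    (fun M hM => ⟨M, hM, h M hM⟩) hP

lemma shortExact_cycles {C : Type*} [Category* C] [Abelian C] (K : CochainComplex C ℤ) (i j : ℤ)
    (hij : i + 1 = j) (h : K.ExactAt j) :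
    (ShortComplex.mk (K.iCycles i) (K.toCycles i j) (by
      rw [← cancel_mono (K.iCycles j)]; simp)).ShortExact where
  exact := by
    have h1 : (ShortComplex.mk (K.iCycles i) (K.d i j) (by simp)).Exact :=
      ShortComplex.exact_of_f_is_kernel _ (K.cyclesIsKernel i j (by simpa using hij))
    let φ : ShortComplex.mk (K.iCycles i) (K.toCycles i j) (by
      rw [← cancel_mono (K.iCycles j)]; simp) ⟶
        ShortComplex.mk (K.iCycles i) (K.d i j) (by simp) :=
      { τ₁ := 𝟙 _
        τ₂ := 𝟙 _
        τ₃ := K.iCycles j }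
    have : Epi φ.τ₁ := by dsimp [φ]; infer_instance
    have : IsIso φ.τ₂ := by dsimp [φ]; infer_instance
    have : Mono φ.τ₃ := by dsimp [φ]; infer_instance
    exact (ShortComplex.exact_iff_of_epi_of_isIso_of_mono φ).2 h1
  mono_f := by dsimp; infer_instance
  epi_g := by
    obtain rfl : (ComplexShape.up ℤ).prev j = i := by simp [← hij]
    exact (HomologicalComplex.exactAt_iff K j).1 h |>.epi_toCycles

lemma gpStep_cycles {P : CochainComplex (ModuleCat.{u} A) ℤ}
    (h₁ : ∀ n : ℤ, Projective (P.X n)) (h₂ : ∀ n : ℤ, P.ExactAt n)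
    (h₃ : ∀ (Q : ModuleCat.{u} A), Projective Q → ∀ (n : ℤ) (f : P.X n ⟶ Q),
      P.d (n-1) n ≫ f = 0 → ∃ g : P.X (n+1) ⟶ Q, f = P.d n (n+1) ≫ g) (n : ℤ) :
    GPStep (P.cycles n) (P.cycles (n + 1)) := by
  refine GPStep.mk _ _ _ (shortExact_cycles P n (n + 1) rfl (h₂ _)) (h₁ n) fun Q hQ a => ?_
  obtain ⟨m, rfl⟩ : ∃ m, n = m + 1 := ⟨n - 1, by ring⟩
  have := (shortExact_cycles P m (m + 1) rfl (h₂ _)).epi_g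
  dsimp at this
  have h0 : P.d (m - 1) m ≫ P.toCycles m (m + 1) ≫ a = 0 := by
    rw [← Category.assoc, HomologicalComplex.d_toCycles, zero_comp]
  obtain ⟨b, hb⟩ := h₃ Q hQ m (P.toCycles m (m + 1) ≫ a) h0
  refine ⟨b, ?_⟩
  rw [← cancel_epi (P.toCycles m (m + 1)), hb, HomologicalComplex.toCycles_i_assoc]

lemma IsGorensteinProjective.exists_steps {G : ModuleCat.{u} A}
    (hG : IsGorensteinProjective G) :
    ∃ (M N M' : ModuleCat.{u} A), IsGorensteinProjective M ∧ GPStep M M' ∧ Nonempty (M' ≅ G) ∧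
      IsGorensteinProjective N ∧ GPStep M' N := by
  obtain ⟨P, h₁, h₂, ⟨i⟩, h₃⟩ := hG
  have key : ∀ n, IsGorensteinProjective (P.cycles n) := fun n => by
    refine isGorensteinProjective_of_closed (fun M => ∃ n, M = P.cycles n) ?_ ?_ ⟨n, rfl⟩
    · rintro _ ⟨n, rfl⟩
      obtain ⟨m, rfl⟩ : ∃ m, n = m + 1 := ⟨n - 1, by ring⟩
      exact ⟨_, ⟨m, rfl⟩, gpStep_cycles h₁ h₂ h₃ m⟩
    · rintro _ ⟨n, rfl⟩
      exact ⟨_, ⟨n + 1, rfl⟩, gpStep_cycles h₁ h₂ h₃ n⟩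
  exact ⟨P.cycles (-1), P.cycles (0 + 1), P.cycles 0, key _, gpStep_cycles h₁ h₂ h₃ (-1), ⟨i.symm⟩,
    key _, gpStep_cycles h₁ h₂ h₃ 0⟩

lemma GPStep.of_iso_right {M N N' : ModuleCat.{u} A} (e : N ≅ N') (h : GPStep M N) :
    GPStep M N' := by
  obtain ⟨P, f, g, w, hS, hP, hQ⟩ := h.exists
  refine GPStep.mk f (g ≫ e.hom) (by rw [reassoc_of% w, zero_comp]) ?_ hP hQ
  let i : ShortComplex.mk f g w ≅
      ShortComplex.mk f (g ≫ e.hom) (by rw [reassoc_of% w, zero_comp]) :=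
    ShortComplex.isoMk (Iso.refl _) (Iso.refl _) e
  exact ShortComplex.shortExact_of_iso i hS

lemma GPStep.of_iso_left {M N M' : ModuleCat.{u} A} (e : M ≅ M') (h : GPStep M N) :
    GPStep M' N := by
  obtain ⟨P, f, g, w, hS, hP, hQ⟩ := h.exists
  refine GPStep.mk (e.inv ≫ f) g (by rw [Category.assoc, w, comp_zero]) ?_ hP ?_
  · let i : ShortComplex.mk f g w ≅
        ShortComplex.mk (e.inv ≫ f) g (by rw [Category.assoc, w, comp_zero]) :=
      ShortComplex.isoMk e (Iso.refl _) (Iso.refl _)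
    exact ShortComplex.shortExact_of_iso i hS
  · intro Q hQ' a
    obtain ⟨b, hb⟩ := hQ Q hQ' (e.hom ≫ a)
    exact ⟨b, by simp [hb]⟩

lemma IsGorensteinProjective.exists_left {G : ModuleCat.{u} A} (hG : IsGorensteinProjective G) :
    ∃ M, IsGorensteinProjective M ∧ GPStep M G := by
  obtain ⟨M, N, M', hM, h, ⟨e⟩, -, -⟩ := hG.exists_steps
  exact ⟨M, hM, h.of_iso_right e⟩

lemma IsGorensteinProjective.exists_right {G : ModuleCat.{u} A} (hG : IsGorensteinProjective G) :
    ∃ N, IsGorensteinProjective N ∧ GPStep G N := by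
  obtain ⟨M, N, M', -, -, ⟨e⟩, hN, h⟩ := hG.exists_steps
  exact ⟨N, hN, h.of_iso_left e⟩

section Perp

variable [HasExt.{w} (ModuleCat.{u} A)]

/-- The class `GP^⊥`. -/
def GPPerp (N : ModuleCat.{u} A) : Prop :=
  ∀ G : ModuleCat.{u} A, IsGorensteinProjective G → Ext1Zero.{w} G N

lemma GPPerp.exists_lift {S : ShortComplex (ModuleCat.{u} A)} (hS : S.ShortExact)
    (h : GPPerp.{w} S.X₁) {G : ModuleCat.{u} A} (hG : IsGorensteinProjective G)
    (v : G ⟶ S.X₃) : ∃ c : G ⟶ S.X₂, c ≫ S.g = v := by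
  have := h G hG
  obtain ⟨c, hc⟩ := Abelian.Ext.covariant_sequence_exact₃ G hS (Abelian.Ext.mk₀ v) (zero_add 1)
    (Subsingleton.elim (h := h G hG) _ _)
  obtain ⟨c, rfl⟩ := (Abelian.Ext.mk₀_bijective _ _).surjective c
  refine ⟨c, ?_⟩
  rw [Abelian.Ext.mk₀_comp_mk₀] at hc
  exact (Abelian.Ext.mk₀_bijective _ _).injective hc

lemma GPPerp.exists_extension {N : ModuleCat.{u} A} {S : ShortComplex (ModuleCat.{u} A)}
    (h : GPPerp.{w} N) (hS : S.ShortExact) (hG : IsGorensteinProjective S.X₃)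
    (v : S.X₁ ⟶ N) : ∃ c : S.X₂ ⟶ N, S.f ≫ c = v := by
  obtain ⟨c, hc⟩ := Abelian.Ext.contravariant_sequence_exact₁ hS N (Abelian.Ext.mk₀ v)
    (add_zero 1) (Subsingleton.elim (h := h S.X₃ hG) _ _)
  obtain ⟨c, rfl⟩ := (Abelian.Ext.mk₀_bijective _ _).surjective c
  refine ⟨c, ?_⟩
  rw [Abelian.Ext.mk₀_comp_mk₀] at hc
  exact (Abelian.Ext.mk₀_bijective _ _).injective hc

lemma ext1Zero_of_extension {N : ModuleCat.{u} A} {S : ShortComplex (ModuleCat.{u} A)}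
    (hS : S.ShortExact) (hP : Projective S.X₂)
    (h : ∀ v : S.X₁ ⟶ N, ∃ c : S.X₂ ⟶ N, S.f ≫ c = v) : Ext1Zero.{w} S.X₃ N := by
  refine subsingleton_of_forall_eq 0 fun x => ?_
  obtain ⟨v, rfl⟩ := Abelian.Ext.contravariant_sequence_exact₃ hS N x
    (Abelian.Ext.eq_zero_of_projective _) (add_zero 1)
  obtain ⟨v, rfl⟩ := (Abelian.Ext.mk₀_bijective _ _).surjective v
  obtain ⟨c, rfl⟩ := h v
  rw [← Abelian.Ext.mk₀_comp_mk₀, ← Abelian.Ext.comp_assoc_of_second_deg_zero]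
  simp

lemma gpPerp_of_projective {Q : ModuleCat.{u} A} (hQ : Projective Q) : GPPerp.{w} Q := by
  intro G hG
  obtain ⟨M, -, h⟩ := hG.exists_left
  obtain ⟨P, f, g, w, hS, hP, hext⟩ := h.exists
  exact ext1Zero_of_extension hS hP (hext Q hQ)

lemma GPPerp.of_iso {M N : ModuleCat.{u} A} (e : M ≅ N) (h : GPPerp.{w} M) : GPPerp.{w} N := by
  intro G hG
  obtain ⟨K, -, hK⟩ := hG.exists_left
  obtain ⟨P, f, g, w, hS, hP, -⟩ := hK.exists
  refine ext1Zero_of_extension hS hP fun v => ?_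
  obtain ⟨c, hc⟩ := h.exists_extension hS hG (v ≫ e.inv)
  refine ⟨c ≫ e.hom, ?_⟩
  dsimp at hc ⊢
  simp [reassoc_of% hc]

lemma GPPerp.cosyzygy {S : ShortComplex (ModuleCat.{u} A)} (hS : S.ShortExact)
    (hI : Injective S.X₂) (h : GPPerp.{w} S.X₁) : GPPerp.{w} S.X₃ := by
  intro G hG
  obtain ⟨K, hK, hKG⟩ := hG.exists_left
  obtain ⟨P, f, g, w, hT, hP, -⟩ := hKG.exists
  have : Mono f := hT.mono_f
  refine ext1Zero_of_extension hT hP fun v => ?_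
  obtain ⟨c, hc⟩ := h.exists_lift hS hK v
  exact ⟨Injective.factorThru c f ≫ S.g, by
    dsimp
    rw [Injective.comp_factorThru_assoc, hc]⟩

end Perp

end GorensteinProjective

open CochainComplex CochainComplex.HomComplex in
lemma nullHomotopic_step {C : Type*} [Category* C] [Abelian C] {K L : CochainComplex C ℤ}
    (f : K ⟶ L) (α : Cochain K L (-1)) (n m : ℤ) (hnm : n + 1 = m)
    [Injective (L.X n)] [Injective (L.X m)]
    (hL : ∀ v : K.homology (m + 1) ⟶ L.X (m + 1), v ≫ L.d (m + 1) (m + 2) = 0 →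
      ∃ c : K.homology (m + 1) ⟶ L.X m, c ≫ L.d m (m + 1) = v)
    (hα : (δ (-1) 0 α).EqUpTo (Cochain.ofHom f) n)
    (hz : K.iCycles m ≫ (f.f m - α.v m n (by lia) ≫ L.d n m) = 0) :
    ∃ (h : K.X (m + 1) ⟶ L.X m),
      (δ (-1) 0 (α + Cochain.single h (-1))).EqUpTo (Cochain.ofHom f) m ∧
      K.iCycles (m + 1) ≫ (f.f (m + 1) -
        (α + Cochain.single h (-1)).v (m + 1) m (by lia) ≫ L.d m (m + 1)) = 0 := by
  subst hnm
  let u := f.f (n + 1) - α.v (n + 1) n (by lia) ≫ L.d n (n + 1) -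
    K.d (n + 1) (n + 1 + 1) ≫ α.v (n + 1 + 1) (n + 1) (by lia)
  have hu : K.iCycles (n + 1) ≫ u = 0 := by
    simp only [u]
    rw [Preadditive.comp_sub, hz]
    simp
  have hex : (ShortComplex.mk (K.iCycles (n + 1)) (K.d (n + 1) (n + 1 + 1)) (by simp)).Exact :=
    ShortComplex.exact_of_f_is_kernel _ (K.cyclesIsKernel (n + 1) (n + 1 + 1) (by simp))
  obtain ⟨β, hβ⟩ : ∃ (β : K.X (n + 1 + 1) ⟶ L.X (n + 1)), K.d (n + 1) (n + 1 + 1) ≫ β = u :=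
    ⟨hex.descToInjective _ hu, hex.comp_descToInjective _ _⟩
  set h₁ := α.v (n + 1 + 1) (n + 1) (by lia) + β with hh₁
  have e₁ : f.f (n + 1) = α.v (n + 1) n (by lia) ≫ L.d n (n + 1) +
      K.d (n + 1) (n + 1 + 1) ≫ h₁ := by
    rw [hh₁, Preadditive.comp_add, hβ]
    simp only [u]
    abel
  let w := K.iCycles (n + 1 + 1) ≫ (f.f (n + 1 + 1) - h₁ ≫ L.d (n + 1) (n + 1 + 1))
  have hw : K.toCycles (n + 1) (n + 1 + 1) ≫ w = 0 := by
    simp only [w, HomologicalComplex.toCycles_i_assoc, Preadditive.comp_sub, ← f.comm, e₁]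
    simp
  obtain ⟨v, hv⟩ : ∃ v, K.homologyπ (n + 1 + 1) ≫ v = w :=
    ⟨_, (CokernelCofork.IsColimit.desc'
      (K.homologyIsCokernel (n + 1) (n + 1 + 1) (by simp)) w hw).2⟩
  obtain ⟨c, hc⟩ := hL v (by
    rw [← cancel_epi (K.homologyπ (n + 1 + 1)), reassoc_of% hv]
    simp only [w, Category.assoc, Preadditive.sub_comp, HomologicalComplex.d_comp_d, comp_zero,
      sub_zero, f.comm, HomologicalComplex.iCycles_d_assoc, zero_comp])
  let e := Injective.factorThru c (K.homologyι (n + 1 + 1))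
  have he : K.homologyι (n + 1 + 1) ≫ e = c := Injective.comp_factorThru _ _
  let γ := K.pOpcycles (n + 1 + 1) ≫ e
  have hγ : K.d (n + 1) (n + 1 + 1) ≫ γ = 0 := by simp [γ]
  have hγ' : K.iCycles (n + 1 + 1) ≫ γ ≫ L.d (n + 1) (n + 1 + 1) = w := by
    simp only [γ, Category.assoc]
    rw [← K.homology_π_ι_assoc, reassoc_of% he, hc, hv]
  refine ⟨β + γ, ?_, ?_⟩
  · intro p q hpq hp
    obtain rfl : p = q := by lia
    obtain hp | rfl := hp.lt_or_eq
    · rw [δ_add, Cochain.add_v, hα p p (by lia) (by lia), add_eq_left,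
        δ_v (-1) 0 (neg_add_cancel 1) _ p p hpq (p - 1) (p + 1) rfl rfl,
        Cochain.single_v_eq_zero _ _ _ _ _ (by lia),
        Cochain.single_v_eq_zero _ _ _ _ _ (by lia)]
      simp
    · rw [δ_v (-1) 0 (neg_add_cancel 1) _ (n + 1) (n + 1) (by lia) n (n + 1 + 1)
        (by lia) (by lia), Cochain.add_v, Cochain.add_v,
        Cochain.single_v_eq_zero _ _ _ _ _ (by lia), Cochain.single_v, Cochain.ofHom_v, e₁,
        hh₁]
      simp [hγ]
  · rw [Cochain.add_v, Cochain.single_v, ← add_assoc, ← hh₁, Preadditive.add_comp, ← sub_sub,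
      Preadditive.comp_sub, hγ', sub_self]

open CochainComplex CochainComplex.HomComplex CochainComplex.HomComplex.Cochain.InductionUp in
lemma nullHomotopic_of_homologyMap_eq_zero {C : Type*} [Category* C] [Abelian C]
    {K L : CochainComplex C ℤ} (f : K ⟶ L) (d : ℤ) (hd : ∀ n < d, IsZero (L.X n))
    (hI : ∀ n, Injective (L.X n))
    (hL : ∀ m, d ≤ m → ∀ v : K.homology (m + 1) ⟶ L.X (m + 1), v ≫ L.d (m + 1) (m + 2) = 0 →
      ∃ c : K.homology (m + 1) ⟶ L.X m, c ≫ L.d m (m + 1) = v)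
    (hf : HomologicalComplex.homologyMap f d = 0) : Nonempty (Homotopy f 0) := by
  let X (n : ℕ) : Set (Cochain K L (-1)) := Set.ofPred (fun α =>
    (δ (-1) 0 α).EqUpTo (Cochain.ofHom f) (n + d - 1) ∧
    K.iCycles (n + d) ≫ (f.f (n + d) - α.v (n + d) (n + d - 1) (by lia) ≫
      L.d (n + d - 1) (n + d)) = 0)
  let x₀ : X 0 := ⟨0, fun p q hpq hp ↦ (hd q (by lia)).eq_of_tgt _ _, by
    have hm : Mono (L.homologyπ d) := by
      apply Preadditive.mono_of_cancel_zero
      intro Z g hg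
      have : IsIso (L.homologyπ d) := by
        refine ShortComplex.isIso_homologyπ _ ?_
        exact (hd _ (by simp)).eq_of_src _ _
      rwa [← cancel_mono (L.homologyπ d), zero_comp]
    have : HomologicalComplex.cyclesMap f d = 0 := by
      rw [← cancel_mono (L.homologyπ d), ← HomologicalComplex.homologyπ_naturality, hf]
      simp
    simp only [Cochain.zero_v, zero_comp, sub_zero]
    rw [show ((0 : ℕ) : ℤ) + d = d by simp, ← HomologicalComplex.cyclesMap_i, this, zero_comp]⟩
  have step (n : ℕ) (α : X n) : ∃ h : K.X (n + d + 1) ⟶ L.X (n + d),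
      α.1 + Cochain.single h (-1) ∈ X (n + 1) := by
    have := hI
    obtain ⟨h, h₁, h₂⟩ := nullHomotopic_step f α.1 (n + d - 1) (n + d) (by lia)
      (hL _ (by lia)) α.2.1 α.2.2
    refine ⟨h, ?_, ?_⟩
    · convert h₁ using 1
      push_cast; ring
    · have a : ((n + 1 : ℕ) : ℤ) + d = n + d + 1 := by push_cast; ring
      have b : ((n + 1 : ℕ) : ℤ) + d - 1 = n + d := by push_cast; ring
      have key : ∀ a b (ha : a = (n : ℤ) + d + 1) (hb : b = (n : ℤ) + d) (hab : a + -1 = b),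
          K.iCycles a ≫ (f.f a - (α.1 + Cochain.single h (-1)).v a b hab ≫ L.d b a) = 0 := by
        rintro _ _ rfl rfl _
        exact h₂
      exact key _ _ a b _
  let φ (n : ℕ) (α : X n) : X (n + 1) := ⟨_, (step n α).choose_spec⟩
  have hφ (k : ℕ) (x : X k) : (φ k x).1.EqUpTo x.1 (d + k) := fun p q hpq hp => by
    dsimp [φ]
    rw [add_eq_left, Cochain.single_v_eq_zero _ _ _ _ _ (by lia)]
  refine ⟨(Cochain.equivHomotopy f 0).symm ⟨limitSequence φ hφ x₀, ?_⟩⟩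
  rw [Cochain.ofHom_zero, add_zero]
  ext n
  let k₀ := (n - d + 1).toNat
  rw [← (sequence φ x₀ k₀).2.1 n n (add_zero n) (by lia),
    δ_v (-1) 0 (neg_add_cancel 1) _ n n (by lia) (n - 1) (n + 1) rfl (by lia),
    δ_v (-1) 0 (neg_add_cancel 1) _ n n (by lia) (n - 1) (n + 1) rfl (by lia),
    limitSequence_eqUpTo φ hφ x₀ k₀ n (n - 1) (by lia) (by lia),
    limitSequence_eqUpTo φ hφ x₀ k₀ (n + 1) n (by lia) (by lia)]

section InjectiveResolution

lemma exists_injective_complex {C : Type*} [Category* C] [Abelian C] [EnoughInjectives C]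
    (N : C) (m : ℤ) :
    ∃ (I : CochainComplex C ℤ) (ε : N ⟶ I.X m) (w : ε ≫ I.d m (m + 1) = 0),
      (∀ n < m, IsZero (I.X n)) ∧ (∀ n, Injective (I.X n)) ∧ I.IsKInjective ∧ Mono ε ∧
      (ShortComplex.mk ε (I.d m (m + 1)) w).Exact ∧ ∀ n, n ≠ m → I.ExactAt n := by
  let r := injectiveResolution N
  let e := ComplexShape.embeddingUpIntGE m
  let I : CochainComplex C ℤ := r.cocomplex.extend e
  have he (k : ℕ) : e.f k = m + k := rfl
  have hn (n : ℤ) (hn : n < m) (k : ℕ) : e.f k ≠ n := by rw [he]; lia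
  have hz (n : ℤ) (h : n < m) : IsZero (I.X n) := r.cocomplex.isZero_extend_X e n (hn n h)
  have hI (n : ℤ) : Injective (I.X n) := by
    by_cases h : n < m
    · exact (hz n h).injective
    · exact Injective.of_iso (r.cocomplex.extendXIso e (i := (n - m).toNat)
        (by rw [he]; lia)).symm inferInstance
  have : I.IsStrictlyGE m := ⟨fun n hn => hz _ (by
    by_contra! h
    exact hn (n - m).toNat (by rw [he]; lia))⟩
  let e₀ := r.cocomplex.extendXIso e (i := 0) (i' := m) (by simp [he])
  let e₁ := r.cocomplex.extendXIso e (i := 1) (i' := m + 1) (by simp [he])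
  have hd : I.d m (m + 1) = e₀.hom ≫ r.cocomplex.d 0 1 ≫ e₁.inv :=
    r.cocomplex.extend_d_eq e _ _
  obtain ⟨ε, hε, w, h₀⟩ : ∃ (ε : N ⟶ r.cocomplex.X 0) (_ : Mono ε)
      (w : ε ≫ r.cocomplex.d 0 1 = 0), (ShortComplex.mk ε _ w).Exact :=
    ⟨r.ι.f 0, inferInstanceAs (Mono (r.ι.f 0)), r.ι_f_zero_comp_complex_d, r.exact₀⟩
  have hw : (ε ≫ e₀.inv) ≫ I.d m (m + 1) = 0 := by
    simp [hd, reassoc_of% w]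
  refine ⟨I, ε ≫ e₀.inv, hw, hz, hI, CochainComplex.isKInjective_of_injective I m,
    mono_comp _ _, ?_, fun n hnm => ?_⟩
  · refine ShortComplex.exact_of_iso (S₁ := .mk ε _ w) (ShortComplex.isoMk (Iso.refl _) e₀.symm
      e₁.symm (by simp) (by simp [hd])) h₀
  · by_cases h : n < m
    · exact HomologicalComplex.exactAt_of_isSupported I e n (hn n h)
    · rw [HomologicalComplex.extend_exactAt_iff (j := (n - m).toNat - 1 + 1) _ _
        (by rw [he]; lia)]
      exact r.cocomplex_exactAt_succ _

variable {A : Type u} [Ring A]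

lemma gpPerp_cycles [HasExt.{w} (ModuleCat.{u} A)] {N : ModuleCat.{u} A} (hN : GPPerp.{w} N)
    {I : CochainComplex (ModuleCat.{u} A) ℤ} {m : ℤ} (ε : N ⟶ I.X m)
    (w : ε ≫ I.d m (m + 1) = 0) (hI : ∀ n, Injective (I.X n)) (hε : Mono ε)
    (h : (ShortComplex.mk ε (I.d m (m + 1)) w).Exact) (hex : ∀ n, n ≠ m → I.ExactAt n)
    (n : ℤ) (hn : m ≤ n) : GPPerp.{w} (I.cycles n) := by
  obtain ⟨k, rfl⟩ := Int.le.dest hn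
  clear hn
  induction k with
  | zero =>
    have : Mono (ShortComplex.mk ε (I.d m (m + 1)) w).f := hε
    simpa using hN.of_iso (h.fIsKernel.conePointUniqueUpToIso
      (I.cyclesIsKernel m (m + 1) (by simp)))
  | succ k ih =>
    have := shortExact_cycles I (m + k) (m + (k + 1 : ℕ)) (by push_cast; ring)
      (hex _ (by push_cast; lia))
    exact GPPerp.cosyzygy this (hI _) ih

lemma exists_injective_complex_of_gpPerp [HasExt.{w} (ModuleCat.{u} A)] {N : ModuleCat.{u} A}
    (hN : GPPerp.{w} N) (m : ℤ) :
    ∃ (I : CochainComplex (ModuleCat.{u} A) ℤ) (ε : N ⟶ I.X m) (w : ε ≫ I.d m (m + 1) = 0),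
      (∀ n < m, IsZero (I.X n)) ∧ I.IsKInjective ∧ Mono ε ∧
      (ShortComplex.mk ε (I.d m (m + 1)) w).Exact ∧ (∀ n, n ≠ m → I.ExactAt n) ∧
      ∀ (K : CochainComplex (ModuleCat.{u} A) ℤ)
        (_ : ∀ n, IsGorensteinProjective (K.homology n)) (f : K ⟶ I),
        HomologicalComplex.homologyMap f m = 0 → Nonempty (Homotopy f 0) := by
  obtain ⟨I, ε, w, hz, hI, hK, hε, h, hex⟩ := exists_injective_complex N m
  refine ⟨I, ε, w, hz, hK, hε, h, hex, fun K hGP f hf =>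
    nullHomotopic_of_homologyMap_eq_zero f m hz hI (fun n hn v hv => ?_) hf⟩
  have hS := shortExact_cycles I n (n + 1) rfl (hex _ (by lia))
  obtain ⟨c, hc⟩ := GPPerp.exists_lift hS (gpPerp_cycles hN ε w hI hε h hex n hn) (hGP (n + 1))
    (I.liftCycles v (n + 2) (by simp; lia) hv)
  refine ⟨c, ?_⟩
  dsimp at hc
  rw [← I.toCycles_i n (n + 1), reassoc_of% hc, HomologicalComplex.liftCycles_i]

end InjectiveResolution

section ProductComplex

variable {A : Type u} [Ring A]

lemma exists_cycles_of_d_eq_zero (K : CochainComplex (ModuleCat.{u} A) ℤ) {n : ℤ} (x : K.X n)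
    (hx : K.d n (n + 1) x = 0) : ∃ z : K.cycles n, K.iCycles n z = x :=
  (ShortComplex.moduleCat_exact_iff _).1 (ShortComplex.exact_of_f_is_kernel
    (ShortComplex.mk (K.iCycles n) (K.d n (n + 1)) (by simp))
    (K.cyclesIsKernel n (n + 1) (by simp))) x hx

lemma exists_boundary_of_homologyπ_eq_zero (K : CochainComplex (ModuleCat.{u} A) ℤ) {n : ℤ}
    (z : K.cycles n) (hz : K.homologyπ n z = 0) :
    ∃ b : K.X (n - 1), K.iCycles n z = K.d (n - 1) n b := by
  obtain ⟨b, hb⟩ := (ShortComplex.moduleCat_exact_iff _).1 (ShortComplex.exact_of_g_is_cokernel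
    (ShortComplex.mk (K.toCycles (n - 1) n) (K.homologyπ n) (by simp))
    (K.homologyIsCokernel (n - 1) n (by simp))) z hz
  refine ⟨b, ?_⟩
  dsimp at hb
  rw [← hb, ← ConcreteCategory.comp_apply, HomologicalComplex.toCycles_i]

lemma homologyπ_surjective (K : CochainComplex (ModuleCat.{u} A) ℤ) (n : ℤ) :
    Function.Surjective (K.homologyπ n) :=
  (ModuleCat.epi_iff_surjective _).1 inferInstance

lemma quasiIso_of_d_eq_zero {K L : CochainComplex (ModuleCat.{u} A) ℤ} (a : K ⟶ L)
    (hK : ∀ i j, K.d i j = 0)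
    (hinj : ∀ n (x : K.X n) (b : L.X (n - 1)), a.f n x = L.d (n - 1) n b → x = 0)
    (hsurj : ∀ n (y : L.X n), L.d n (n + 1) y = 0 →
      ∃ (x : K.X n) (b : L.X (n - 1)), y = a.f n x + L.d (n - 1) n b) : QuasiIso a where
  quasiIsoAt n := by
    rw [quasiIsoAt_iff_isIso_homologyMap, ConcreteCategory.isIso_iff_bijective]
    have hc (z : K.cycles n) : L.iCycles n (HomologicalComplex.cyclesMap a n z) =
        a.f n (K.iCycles n z) := by
      simp only [← ConcreteCategory.comp_apply, HomologicalComplex.cyclesMap_i]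
    have hπ (z : K.cycles n) : HomologicalComplex.homologyMap a n (K.homologyπ n z) =
        L.homologyπ n (HomologicalComplex.cyclesMap a n z) := by
      simp only [← ConcreteCategory.comp_apply, HomologicalComplex.homologyπ_naturality]
    constructor
    · rw [injective_iff_map_eq_zero]
      intro ξ hξ
      obtain ⟨z, rfl⟩ := homologyπ_surjective K n ξ
      rw [hπ] at hξ
      obtain ⟨b, hb⟩ := exists_boundary_of_homologyπ_eq_zero L _ hξ
      rw [hc] at hb
      have h0 := hinj n _ b hb
      have : z = 0 := (ModuleCat.mono_iff_injective (K.iCycles n)).1 inferInstance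
        (by rw [h0, map_zero])
      rw [this, map_zero]
    · intro η
      obtain ⟨y, rfl⟩ := homologyπ_surjective L n η
      obtain ⟨x, b, hxb⟩ := hsurj n (L.iCycles n y) (by
        rw [← ConcreteCategory.comp_apply, HomologicalComplex.iCycles_d]; rfl)
      obtain ⟨z, rfl⟩ := exists_cycles_of_d_eq_zero K x (by rw [hK]; rfl)
      refine ⟨K.homologyπ n z, ?_⟩
      rw [hπ]
      have : y = HomologicalComplex.cyclesMap a n z + L.toCycles (n - 1) n b := by
        apply (ModuleCat.mono_iff_injective (L.iCycles n)).1 inferInstance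
        rw [hxb, map_add, hc, ← ConcreteCategory.comp_apply (L.toCycles _ _),
          HomologicalComplex.toCycles_i]
      rw [this, map_add, ← ConcreteCategory.comp_apply (L.toCycles _ _)]
      simp

/-- The degreewise product of a family of complexes of modules. -/
def piComplex (I : ℤ → CochainComplex (ModuleCat.{u} A) ℤ) :
    CochainComplex (ModuleCat.{u} A) ℤ where
  X n := ModuleCat.of A (∀ m, (I m).X n)
  d i j := ModuleCat.ofHom (LinearMap.pi fun m => ((I m).d i j).hom ∘ₗ LinearMap.proj m)
  shape i j h := by
    ext x m
    simp [(I m).shape i j h]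
    rfl
  d_comp_d' i j k _ _ := by
    ext x m
    change (I m).d j k ((I m).d i j (x m)) = 0
    rw [← ConcreteCategory.comp_apply, HomologicalComplex.d_comp_d]
    rfl

variable (I : ℤ → CochainComplex (ModuleCat.{u} A) ℤ)

lemma piComplex_d_apply (i j m : ℤ) (x : (piComplex I).X i) :
    (piComplex I).d i j x m = (I m).d i j (x m) := rfl

/-- The projections of the degreewise product. -/
def piComplexπ (m : ℤ) : piComplex I ⟶ I m where
  f _ := ModuleCat.ofHom (LinearMap.proj m)
  comm' _ _ _ := rfl

variable {I} in
lemma piComplex_hom_ext {M : ModuleCat.{u} A} {n : ℤ} {f g : M ⟶ (piComplex I).X n}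
    (h : ∀ m, f ≫ (piComplexπ I m).f n = g ≫ (piComplexπ I m).f n) : f = g := by
  ext x
  funext m
  exact ConcreteCategory.congr_hom (h m) x

/-- Morphisms to a term of the degreewise product. -/
def piComplexLiftX {M : ModuleCat.{u} A} {n : ℤ} (f : ∀ m, M ⟶ (I m).X n) :
    M ⟶ (piComplex I).X n :=
  ModuleCat.ofHom (LinearMap.pi fun m => (f m).hom)

lemma piComplexLiftX_π {M : ModuleCat.{u} A} {n : ℤ} (f : ∀ m, M ⟶ (I m).X n) (m : ℤ) :
    piComplexLiftX I f ≫ (piComplexπ I m).f n = f m := rfl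

/-- Chain maps to the degreewise product. -/
def piComplexLift {K : CochainComplex (ModuleCat.{u} A) ℤ} (f : ∀ m, K ⟶ I m) :
    K ⟶ piComplex I where
  f n := piComplexLiftX I fun m => (f m).f n
  comm' i j _ := by
    refine piComplex_hom_ext fun m => ?_
    rw [Category.assoc, Category.assoc, ← HomologicalComplex.Hom.comm, piComplexLiftX_π,
      ← Category.assoc, piComplexLiftX_π, HomologicalComplex.Hom.comm]

lemma piComplexLift_f_apply {K : CochainComplex (ModuleCat.{u} A) ℤ} (f : ∀ m, K ⟶ I m)
    (n m : ℤ) (x : K.X n) : (piComplexLift I f).f n x m = (f m).f n x := rfl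

variable {I} in
lemma nonempty_homotopy_zero_of_piComplex {K : CochainComplex (ModuleCat.{u} A) ℤ}
    (f : K ⟶ piComplex I) (h : ∀ m, Nonempty (Homotopy (f ≫ piComplexπ I m) 0)) :
    Nonempty (Homotopy f 0) := by
  let H (m : ℤ) := (h m).some
  refine ⟨{ hom := fun i j => piComplexLiftX I fun m => (H m).hom i j
            zero := fun i j hij => piComplex_hom_ext fun m => ?_
            comm := fun i => piComplex_hom_ext fun m => ?_ }⟩
  · rw [piComplexLiftX_π, (H m).zero i j hij, zero_comp]
  · have := (H m).comm i
    simp only [HomologicalComplex.comp_f, HomologicalComplex.zero_f, add_zero] at this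
    rw [this]
    simp only [HomologicalComplex.zero_f, add_zero, Preadditive.add_comp,
      ← dNext_comp_right, ← prevD_comp_right, piComplexLiftX_π]

instance [∀ m, (I m).IsKInjective] : (piComplex I).IsKInjective where
  nonempty_homotopy_zero f hK := nonempty_homotopy_zero_of_piComplex f fun m =>
    CochainComplex.IsKInjective.nonempty_homotopy_zero (f ≫ piComplexπ I m) hK

end ProductComplex

section ZeroDifferential

variable {A : Type u} [Ring A]

lemma exists_kInjective_of_d_eq_zero [HasExt.{w} (ModuleCat.{u} A)]
    (K : CochainComplex (ModuleCat.{u} A) ℤ) (hd : ∀ i j, K.d i j = 0)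
    (hK : ∀ n, GPPerp.{w} (K.X n)) :
    ∃ (J : CochainComplex (ModuleCat.{u} A) ℤ) (a : K ⟶ J), QuasiIso a ∧ J.IsKInjective ∧
      ∀ (L : CochainComplex (ModuleCat.{u} A) ℤ)
        (_ : ∀ n, IsGorensteinProjective (L.homology n)) (f : L ⟶ J),
        (∀ n, HomologicalComplex.homologyMap f n = 0) → Nonempty (Homotopy f 0) := by
  choose I ε w hz hI hε hex hI' hL using
    fun m => exists_injective_complex_of_gpPerp (hK m) m
  let a (m : ℤ) : K ⟶ I m :=
    { f n := if h : n = m then (K.XIsoOfEq h).hom ≫ ε m ≫ ((I m).XIsoOfEq h.symm).hom else 0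
      comm' i j hij := by
        rw [hd, zero_comp]
        split_ifs with h
        · subst h
          obtain rfl : i + 1 = j := hij
          simp [w]
        · simp }
  have ha (m : ℤ) : (a m).f m = ε m := by simp [a]
  have ha' (m n : ℤ) (h : n ≠ m) : (a m).f n = 0 := by simp [a, h]
  refine ⟨piComplex I, piComplexLift I a, quasiIso_of_d_eq_zero _ hd ?_ ?_, inferInstance,
    fun L hGP f hf => nonempty_homotopy_zero_of_piComplex f fun m => hL m L hGP _ ?_⟩
  · intro n x b hxb
    have h := congr_fun hxb n
    rw [piComplexLift_f_apply, piComplex_d_apply, ha,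
      (hz n (n - 1) (by lia)).eq_of_src ((I n).d (n - 1) n) 0] at h
    exact (ModuleCat.mono_iff_injective (ε n)).1 inferInstance (h.trans (map_zero _).symm)
  · intro n y hy
    have hy' (m : ℤ) : (I m).d n (n + 1) (y m) = 0 := congr_fun hy m
    obtain ⟨x, hx⟩ := (ShortComplex.moduleCat_exact_iff _).1 (hex n) (y n) (hy' n)
    have hb (m : ℤ) : ∃ b : (I m).X (n - 1), m ≠ n → (I m).d (n - 1) n b = y m := by
      by_cases h : m = n
      · exact ⟨0, fun h' => (h' h).elim⟩
      · obtain ⟨b, hb⟩ := (ShortComplex.moduleCat_exact_iff _).1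
          (((I m).exactAt_iff' (n - 1) n (n + 1) (by simp) (by simp)).1 (hI' m n (Ne.symm h)))
          (y m) (hy' m)
        exact ⟨b, fun _ => hb⟩
    choose b hb using hb
    refine ⟨x, Function.update b n 0, ?_⟩
    funext m
    change y m = (a m).f n x + (I m).d (n - 1) n (Function.update b n 0 m)
    by_cases h : m = n
    · subst h
      rw [Function.update_self, map_zero, add_zero, ha]
      exact hx.symm
    · rw [Function.update_of_ne h, hb m h, ha' _ _ (Ne.symm h)]
      exact (zero_add _).symm
  · rw [HomologicalComplex.homologyMap_comp, hf, zero_comp]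

variable [HasDerivedCategory.{w} (ModuleCat.{u} A)]

lemma exists_Q_map_eq {L J : CochainComplex (ModuleCat.{u} A) ℤ} [J.IsKInjective]
    (ψ : Q.obj L ⟶ Q.obj J) : ∃ f : L ⟶ J, Q.map f = ψ := by
  obtain ⟨g, hg⟩ := (CochainComplex.IsKInjective.Qh_map_bijective
    ((HomotopyCategory.quotient _ _).obj L) J).surjective
    ((quotientCompQhIso _).hom.app L ≫ ψ ≫ (quotientCompQhIso _).inv.app J)
  obtain ⟨f, rfl⟩ := (HomotopyCategory.quotient _ _).map_surjective g
  refine ⟨f, ?_⟩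
  rw [← cancel_epi ((quotientCompQhIso _).hom.app L), ← (quotientCompQhIso _).hom.naturality f]
  simp [hg]

lemma homologyMap_eq_zero_of_Q_map {L J : CochainComplex (ModuleCat.{u} A) ℤ} (f : L ⟶ J) (n : ℤ)
    (h : (homologyFunctor _ n).map (Q.map f) = 0) : HomologicalComplex.homologyMap f n = 0 := by
  have := homologyFunctorFactors_hom_naturality f n
  rw [h, zero_comp] at this
  exact (cancel_epi ((homologyFunctorFactors (ModuleCat.{u} A) n).hom.app L)).1
    (this.symm.trans comp_zero.symm)

lemma eq_zero_of_homology_eq_zero [HasExt.{w} (ModuleCat.{u} A)]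
    {X : DerivedCategory (ModuleCat.{u} A)}
    (hX : ∀ n, IsGorensteinProjective ((homologyFunctor _ n).obj X))
    {K : CochainComplex (ModuleCat.{u} A) ℤ} (hd : ∀ i j, K.d i j = 0)
    (hK : ∀ n, GPPerp.{w} (K.X n)) (φ : X ⟶ Q.obj K)
    (hφ : ∀ n, (homologyFunctor _ n).map φ = 0) : φ = 0 := by
  obtain ⟨J, a, ha, hJ, h⟩ := exists_kInjective_of_d_eq_zero K hd hK
  let e := Q.objObjPreimageIso X
  obtain ⟨f, hf⟩ := exists_Q_map_eq (e.hom ≫ φ ≫ Q.map a)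
  obtain ⟨H⟩ := h _ (fun n => (hX n).of_iso ((homologyFunctor _ n).mapIso e.symm ≪≫
    (homologyFunctorFactors _ n).app _)) f fun n => homologyMap_eq_zero_of_Q_map f n (by
      rw [hf]; simp [hφ])
  rw [← cancel_epi e.hom, ← cancel_mono (Q.map a), Category.assoc, ← hf, comp_zero, zero_comp]
  exact (HomologicalComplexUpToQuasiIso.Q_map_eq_of_homotopy H).trans (Q.map_zero _ _)

end ZeroDifferential

section ProjectiveClass

variable {A : Type u} [Ring A]

lemma coproduct_hom_ext {J : Type u} (F : J → CochainComplex (ModuleCat.{u} A) ℤ) (n : ℤ)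
    {M : ModuleCat.{u} A} {f g : (∐ F).X n ⟶ M}
    (h : ∀ j, (Sigma.ι F j).f n ≫ f = (Sigma.ι F j).f n ≫ g) : f = g :=
  (isColimitOfPreserves (HomologicalComplex.eval _ _ n)
    (colimit.isColimit (Discrete.functor F))).hom_ext fun j => h j.as

lemma coproduct_exists_desc {J : Type u} (F : J → CochainComplex (ModuleCat.{u} A) ℤ) (n : ℤ)
    {M : ModuleCat.{u} A} (k : ∀ j, (F j).X n ⟶ M) :
    ∃ f : (∐ F).X n ⟶ M, ∀ j, (Sigma.ι F j).f n ≫ f = k j := by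
  let hc := isColimitOfPreserves (HomologicalComplex.eval _ _ n)
    (colimit.isColimit (Discrete.functor F))
  exact ⟨hc.desc (Cocone.mk M (Discrete.natTrans fun j => k j.as)),
    fun j => hc.fac (Cocone.mk M (Discrete.natTrans fun j => k j.as)) ⟨j⟩⟩

lemma coproduct_d_eq_zero {J : Type u} (F : J → CochainComplex (ModuleCat.{u} A) ℤ)
    (h : ∀ j m n, (F j).d m n = 0) (m n : ℤ) : (∐ F).d m n = 0 :=
  coproduct_hom_ext F m fun j => by simp [h]

lemma projective_coproduct_X {J : Type u} (F : J → CochainComplex (ModuleCat.{u} A) ℤ) (n : ℤ)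
    (h : ∀ j, Projective ((F j).X n)) : Projective ((∐ F).X n) where
  factors f e _ := by
    choose k hk using fun j => (h j).factors ((Sigma.ι F j).f n ≫ f) e
    obtain ⟨f', hf'⟩ := coproduct_exists_desc F n k
    exact ⟨f', coproduct_hom_ext F n fun j => by rw [reassoc_of% hf', hk]⟩

lemma projective_single_X {P : ModuleCat.{u} A} (hP : Projective P) (m n : ℤ) :
    Projective (((HomologicalComplex.single _ (ComplexShape.up ℤ) m).obj P).X n) := by
  by_cases h : n = m
  · exact Projective.of_iso (HomologicalComplex.singleObjXIsoOfEq _ _ _ _ h).symm hP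
  · exact (HomologicalComplex.isZero_single_obj_X _ _ _ _ h).projective

lemma single_shift_d (M : ModuleCat.{u} A) (s m n : ℤ) :
    (((HomologicalComplex.single _ (ComplexShape.up ℤ) 0).obj M)⟦s⟧ :
      CochainComplex (ModuleCat.{u} A) ℤ).d m n = 0 := by
  simp [HomologicalComplex.single_obj_d]
  rfl

/-- The complex with given terms and zero differential. -/
def grComplex (M : ℤ → ModuleCat.{u} A) : CochainComplex (ModuleCat.{u} A) ℤ where
  X := M
  d _ _ := 0

lemma grComplex_d (M : ℤ → ModuleCat.{u} A) (i j : ℤ) : (grComplex M).d i j = 0 := rfl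

/-- For a complex with zero differential, homology agrees with the terms. -/
def homologyIsoOfZeroD (K : CochainComplex (ModuleCat.{u} A) ℤ) (hd : ∀ i j, K.d i j = 0)
    (n : ℤ) : K.homology n ≅ K.X n :=
  have := K.isIso_homologyπ (n - 1) n (by simp) (hd _ _)
  have := K.isIso_iCycles n (n + 1) (by simp) (hd _ _)
  (asIso (K.homologyπ n)).symm ≪≫ asIso (K.iCycles n)

lemma homologyπ_homologyIsoOfZeroD (K : CochainComplex (ModuleCat.{u} A) ℤ)
    (hd : ∀ i j, K.d i j = 0) (n : ℤ) :
    K.homologyπ n ≫ (homologyIsoOfZeroD K hd n).hom = K.iCycles n := by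
  simp [homologyIsoOfZeroD]

lemma exists_homologyMap_eq {K L : CochainComplex (ModuleCat.{u} A) ℤ}
    (hd : ∀ i j, K.d i j = 0) (hK : ∀ n, Projective (K.X n))
    (t : ∀ n, K.homology n ⟶ L.homology n) :
    ∃ f : K ⟶ L, ∀ n, HomologicalComplex.homologyMap f n = t n := by
  choose c hc using fun n => (hK n).factors ((homologyIsoOfZeroD K hd n).inv ≫ t n)
    (L.homologyπ n)
  let f : K ⟶ L :=
    { f n := c n ≫ L.iCycles n
      comm' i j _ := by simp [hd] }
  refine ⟨f, fun n => ?_⟩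
  have hf : HomologicalComplex.cyclesMap f n = K.iCycles n ≫ c n := by
    rw [← cancel_mono (L.iCycles n)]
    simp [f]
  rw [← cancel_epi (K.homologyπ n), HomologicalComplex.homologyπ_naturality, hf, Category.assoc,
    hc, ← homologyπ_homologyIsoOfZeroD K hd n]
  simp

variable [HasDerivedCategory.{w} (ModuleCat.{u} A)]

lemma memP1.exists_retract {E : DerivedCategory (ModuleCat.{u} A)} (hE : memP1 E) :
    ∃ (K : CochainComplex (ModuleCat.{u} A) ℤ) (_ : ∀ i j, K.d i j = 0)
      (_ : ∀ n, Projective (K.X n)) (i : E ⟶ Q.obj K) (r : Q.obj K ⟶ E), i ≫ r = 𝟙 E := by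
  obtain ⟨J, P, n, hP, i, r, hir⟩ := hE
  exact ⟨_, coproduct_d_eq_zero _ fun j _ _ => single_shift_d _ _ _ _,
    fun m => projective_coproduct_X _ m fun j => projective_single_X (hP j) 0 (m + n j), i, r, hir⟩

lemma memP1_grComplex {P : ℤ → ModuleCat.{u} A} (hP : ∀ n, Projective (P n)) :
    memP1 (Q.obj (grComplex P)) := by
  let F (j : ULift.{u} ℤ) : CochainComplex (ModuleCat.{u} A) ℤ :=
    ((HomologicalComplex.single (ModuleCat.{u} A) (ComplexShape.up ℤ) 0).obj
      (P j.down))⟦-j.down⟧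
  have hF (j : ULift.{u} ℤ) (m n : ℤ) : (F j).d m n = 0 := single_shift_d _ _ _ _
  let e (j : ULift.{u} ℤ) : (F j).X j.down ≅ P j.down :=
    HomologicalComplex.singleObjXIsoOfEq (ComplexShape.up ℤ) 0 (P j.down)
      (j.down + -j.down) (by lia)
  let k (j : ULift.{u} ℤ) : F j ⟶ grComplex P :=
    { f n := if h : j.down = n then ((F j).XIsoOfEq h).inv ≫ (e j).hom ≫ eqToHom (by rw [h]; rfl)
        else 0
      comm' _ _ _ := by simp [hF, grComplex_d] }
  have hk (j : ULift.{u} ℤ) : (k j).f j.down = (e j).hom := by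
    simp only [k, dite_true]
    rw [HomologicalComplex.XIsoOfEq_rfl]
    simp only [Iso.refl_inv, Category.id_comp]
    exact Category.comp_id _
  let i : grComplex P ⟶ ∐ F :=
    { f n := (e ⟨n⟩).inv ≫ (Sigma.ι F ⟨n⟩).f n
      comm' _ _ _ := by rw [coproduct_d_eq_zero F hF, grComplex_d]; simp }
  let r : ∐ F ⟶ grComplex P := Sigma.desc k
  have hir : i ≫ r = 𝟙 _ := by
    ext1 n
    have h : (Sigma.ι F ⟨n⟩).f n ≫ r.f n = (e ⟨n⟩).hom := by
      rw [← HomologicalComplex.comp_f, Sigma.ι_desc]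
      exact hk ⟨n⟩
    exact (Category.assoc _ _ _).trans
      ((congrArg ((e ⟨n⟩).inv ≫ ·) h).trans (e ⟨n⟩).inv_hom_id)
  exact ⟨ULift.{u} ℤ, fun j => P j.down, fun j => -j.down, fun j => hP _, Q.map i, Q.map r,
    (Q.map_comp i r).symm.trans ((congrArg Q.map hir).trans (Q.map_id _))⟩

/-- The homology of the image of a complex in the derived category. -/
def homologyQIso (K : CochainComplex (ModuleCat.{u} A) ℤ) (n : ℤ) :
    (homologyFunctor _ n).obj (Q.obj K) ≅ K.homology n :=
  (homologyFunctorFactors _ n).app K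

lemma homologyFunctor_map_Q_map {K L : CochainComplex (ModuleCat.{u} A) ℤ} (f : K ⟶ L) (n : ℤ) :
    (homologyFunctor _ n).map (Q.map f) =
      (homologyQIso K n).hom ≫ HomologicalComplex.homologyMap f n ≫ (homologyQIso L n).inv := by
  rw [← Category.assoc, Iso.eq_comp_inv]
  exact homologyFunctorFactors_hom_naturality f n

lemma memP1.exists_hom {E X : DerivedCategory (ModuleCat.{u} A)} (hE : memP1 E)
    (v : ∀ n, (homologyFunctor _ n).obj E ⟶ (homologyFunctor _ n).obj X) :
    ∃ φ : E ⟶ X, ∀ n, (homologyFunctor _ n).map φ = v n := by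
  obtain ⟨K, hd, hK, i, r, hir⟩ := hE.exists_retract
  let e := Q.objObjPreimageIso X
  obtain ⟨f, hf⟩ := exists_homologyMap_eq (L := Q.objPreimage X) hd hK fun n =>
    (homologyQIso K n).inv ≫ (homologyFunctor _ n).map r ≫ v n ≫
      (homologyFunctor _ n).map e.inv ≫ (homologyQIso _ n).hom
  refine ⟨i ≫ Q.map f ≫ e.hom, fun n => ?_⟩
  rw [Functor.map_comp, Functor.map_comp, homologyFunctor_map_Q_map, hf]
  simp only [Category.assoc, Iso.hom_inv_id_assoc]
  rw [← Functor.map_comp_assoc, hir, CategoryTheory.Functor.map_id, Category.id_comp,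
    ← Functor.map_comp, Iso.inv_hom_id, CategoryTheory.Functor.map_id, Category.comp_id]

/-- The homology of an object given by a complex with zero differential. -/
def homologyQIsoOfZeroD (K : CochainComplex (ModuleCat.{u} A) ℤ) (hd : ∀ i j, K.d i j = 0)
    (n : ℤ) : (homologyFunctor _ n).obj (Q.obj K) ≅ K.X n :=
  homologyQIso K n ≪≫ homologyIsoOfZeroD K hd n

lemma memP1.projective_homology {E : DerivedCategory (ModuleCat.{u} A)} (hE : memP1 E) (n : ℤ) :
    Projective ((homologyFunctor _ n).obj E) := by
  obtain ⟨K, hd, hK, i, r, hir⟩ := hE.exists_retract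
  have : Projective ((homologyFunctor _ n).obj (Q.obj K)) :=
    Projective.of_iso (homologyQIsoOfZeroD K hd n).symm (hK n)
  exact Retract.projective (Y := (homologyFunctor _ n).obj (Q.obj K))
    { i := (homologyFunctor _ n).map i
      r := (homologyFunctor _ n).map r
      retract := by rw [← Functor.map_comp, hir, CategoryTheory.Functor.map_id] }

lemma memP1.eq_zero_of_homology_eq_zero [HasExt.{w} (ModuleCat.{u} A)]
    {X P : DerivedCategory (ModuleCat.{u} A)} (hP : memP1 P)
    (hX : ∀ n, IsGorensteinProjective ((homologyFunctor _ n).obj X)) (φ : X ⟶ P)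
    (hφ : ∀ n, (homologyFunctor _ n).map φ = 0) : φ = 0 := by
  obtain ⟨K, hd, hK, i, r, hir⟩ := hP.exists_retract
  have : φ ≫ i = 0 := _root_.eq_zero_of_homology_eq_zero hX hd
    (fun n => gpPerp_of_projective (hK n)) _ fun n => by rw [Functor.map_comp, hφ, zero_comp]
  rw [← Category.comp_id φ, ← hir, reassoc_of% this, zero_comp]

end ProjectiveClass

section Triangles

variable {A : Type u} [Ring A]

lemma nonempty_iso_of_shortExact_of_epi {M P N M' P' : ModuleCat.{u} A} {f : M ⟶ P} {g : P ⟶ N}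
    {f' : M' ⟶ P'} {g' : P' ⟶ N} {w : f ≫ g = 0} {w' : f' ≫ g' = 0}
    (h : (ShortComplex.mk f g w).ShortExact) (h' : (ShortComplex.mk f' g' w').ShortExact)
    (e : P ≅ P') (he : e.hom ≫ g' = g) : Nonempty (M ≅ M') := by
  have := h.mono_f
  have := h'.mono_f
  obtain ⟨a, ha : a ≫ f' = f ≫ e.hom⟩ :=
    h'.exact.lift' (f ≫ e.hom) (by simpa [he] using w)
  obtain ⟨b, hb : b ≫ f = f' ≫ e.inv⟩ :=
    h.exact.lift' (f' ≫ e.inv) (by simp [← he, w'])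
  dsimp at *
  exact ⟨⟨a, b, by rw [← cancel_mono f]; simp [hb, reassoc_of% ha],
    by rw [← cancel_mono f']; simp [ha, reassoc_of% hb]⟩⟩

lemma nonempty_iso_of_shortExact_of_mono {M P N P' N' : ModuleCat.{u} A} {f : M ⟶ P} {g : P ⟶ N}
    {f' : M ⟶ P'} {g' : P' ⟶ N'} {w : f ≫ g = 0} {w' : f' ≫ g' = 0}
    (h : (ShortComplex.mk f g w).ShortExact) (h' : (ShortComplex.mk f' g' w').ShortExact)
    (e : P ≅ P') (he : f ≫ e.hom = f') : Nonempty (N ≅ N') := by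
  have := h.epi_g
  have := h'.epi_g
  obtain ⟨a, ha : g ≫ a = e.hom ≫ g'⟩ :=
    h.exact.desc' (e.hom ≫ g') (by dsimp; rw [reassoc_of% he, w'])
  obtain ⟨b, hb : g' ≫ b = e.inv ≫ g⟩ :=
    h'.exact.desc' (e.inv ≫ g) (by simp [← he, w])
  dsimp at *
  exact ⟨⟨a, b, by rw [← cancel_epi g]; simp [hb, reassoc_of% ha],
    by rw [← cancel_epi g']; simp [ha, reassoc_of% hb]⟩⟩

variable [HasDerivedCategory.{w} (ModuleCat.{u} A)]

lemma homologyFunctor_map_comp_eq_zero {X Y Z : DerivedCategory (ModuleCat.{u} A)}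
    {f : X ⟶ Y} {g : Y ⟶ Z} (w : f ≫ g = 0) (n : ℤ) :
    (homologyFunctor _ n).map f ≫ (homologyFunctor _ n).map g = 0 := by
  rw [← Functor.map_comp, w, Functor.map_zero]

lemma GhostTriangle.comp_eq_zero {X Y Z : DerivedCategory (ModuleCat.{u} A)}
    {f : X ⟶ Y} {g : Y ⟶ Z} {h : Z ⟶ X⟦(1:ℤ)⟧} (hT : GhostTriangle f g h) : f ≫ g = 0 :=
  comp_distTriang_mor_zero₁₂ _ hT.1

lemma GhostTriangle.shortExact {X Y Z : DerivedCategory (ModuleCat.{u} A)}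
    {f : X ⟶ Y} {g : Y ⟶ Z} {h : Z ⟶ X⟦(1:ℤ)⟧} (hT : GhostTriangle f g h) (n : ℤ) :
    (ShortComplex.mk _ _ (homologyFunctor_map_comp_eq_zero hT.comp_eq_zero n)).ShortExact where
  exact := HomologySequence.exact₂ _ hT.1 n
  mono_f := (ModuleCat.mono_iff_injective _).2 (hT.2 n).1
  epi_g := (ModuleCat.epi_iff_surjective _).2 (hT.2 n).2.1

lemma GhostTriangle.exists_desc {X Y Z : DerivedCategory (ModuleCat.{u} A)}
    {f : X ⟶ Y} {g : Y ⟶ Z} {h : Z ⟶ X⟦(1:ℤ)⟧} (hT : GhostTriangle f g h)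
    {W : DerivedCategory (ModuleCat.{u} A)} (φ : Y ⟶ W) (hφ : f ≫ φ = 0) :
    ∃ ψ : Z ⟶ W, φ = g ≫ ψ :=
  Triangle.yoneda_exact₂ _ hT.1 φ hφ

lemma ghostTriangle_of_epi {X Y Z : DerivedCategory (ModuleCat.{u} A)}
    {f : X ⟶ Y} {g : Y ⟶ Z} {h : Z ⟶ X⟦(1:ℤ)⟧}
    (hT : Triangle.mk f g h ∈ distTriang (DerivedCategory (ModuleCat.{u} A)))
    (hg : ∀ n, Epi ((homologyFunctor _ n).map g)) : GhostTriangle f g h := by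
  have hS (n : ℤ) : (ShortComplex.mk _ _
      (homologyFunctor_map_comp_eq_zero (comp_distTriang_mor_zero₁₂ _ hT) n)).ShortExact :=
    { exact := HomologySequence.exact₂ _ hT n
      mono_f := (HomologySequence.mono_homologyMap_mor₁_iff _ hT (n - 1) n).2
        ((HomologySequence.epi_homologyMap_mor₂_iff _ hT (n - 1) n).1 (hg _))
      epi_g := hg n }
  exact ⟨hT, fun n => ⟨(hS n).moduleCat_injective_f, (hS n).moduleCat_surjective_g,
    (ShortComplex.ShortExact.moduleCat_exact_iff_function_exact _).1 (hS n).exact⟩⟩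

lemma ghostTriangle_of_mono {X Y Z : DerivedCategory (ModuleCat.{u} A)}
    {f : X ⟶ Y} {g : Y ⟶ Z} {h : Z ⟶ X⟦(1:ℤ)⟧}
    (hT : Triangle.mk f g h ∈ distTriang (DerivedCategory (ModuleCat.{u} A)))
    (hf : ∀ n, Mono ((homologyFunctor _ n).map f)) : GhostTriangle f g h :=
  ghostTriangle_of_epi hT fun n => (HomologySequence.epi_homologyMap_mor₂_iff _ hT n (n + 1)).2
    ((HomologySequence.mono_homologyMap_mor₁_iff _ hT n (n + 1)).1 (hf _))

variable (A) in
/-- The objects of the derived category with Gorenstein projective homology. -/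
def GPHomology (X : DerivedCategory (ModuleCat.{u} A)) : Prop :=
  ∀ n, IsGorensteinProjective ((homologyFunctor _ n).obj X)

lemma memP1.gpHomology {E : DerivedCategory (ModuleCat.{u} A)} (hE : memP1 E) : GPHomology A E :=
  fun n => isGorensteinProjective_of_projective (hE.projective_homology n)

/-- There is a ghost triangle `Y ⟶ E ⟶ X ⟶ Y⟦1⟧` with `E` in the projective class. -/
def ProjectiveGhost (Y X : DerivedCategory (ModuleCat.{u} A)) : Prop :=
  ∃ (E : DerivedCategory (ModuleCat.{u} A)) (_ : memP1 E) (f : Y ⟶ E) (g : E ⟶ X)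
    (h : X ⟶ Y⟦(1:ℤ)⟧), GhostTriangle f g h

lemma GPHomology.exists_left {X : DerivedCategory (ModuleCat.{u} A)} (hX : GPHomology A X) :
    ∃ Y, GPHomology A Y ∧ ProjectiveGhost Y X := by
  choose M hM hMX using fun n => (hX n).exists_left
  choose P f g w hS hP _ using fun n => (hMX n).exists
  let e (n : ℤ) : (homologyFunctor _ n).obj (Q.obj (grComplex P)) ≅ P n :=
    homologyQIsoOfZeroD _ (grComplex_d P) n
  obtain ⟨q, hq⟩ := (memP1_grComplex hP).exists_hom (X := X) fun n => (e n).hom ≫ g n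
  obtain ⟨Y, i, h, hT⟩ := distinguished_cocone_triangle₁ q
  have hgh : GhostTriangle i q h := ghostTriangle_of_epi hT fun n => by
    have : Epi (g n) := (hS n).epi_g
    rw [hq]
    exact epi_comp _ _
  refine ⟨Y, fun n => ?_, _, memP1_grComplex hP, i, q, h, hgh⟩
  obtain ⟨a⟩ := nonempty_iso_of_shortExact_of_epi (hgh.shortExact n) (hS n) (e n) (hq n).symm
  exact (hM n).of_iso a.symm

lemma GPHomology.exists_hom [HasExt.{w} (ModuleCat.{u} A)]
    {X : DerivedCategory (ModuleCat.{u} A)} (hX : GPHomology A X)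
    {K : CochainComplex (ModuleCat.{u} A) ℤ} (hd : ∀ i j, K.d i j = 0)
    (hK : ∀ n, GPPerp.{w} (K.X n))
    (v : ∀ n, (homologyFunctor _ n).obj X ⟶ (homologyFunctor _ n).obj (Q.obj K)) :
    ∃ φ : X ⟶ Q.obj K, ∀ n, (homologyFunctor _ n).map φ = v n := by
  obtain ⟨Y, hY, E, hE, f, g, h, hT⟩ := hX.exists_left
  obtain ⟨ψ, hψ⟩ := hE.exists_hom fun n => (homologyFunctor _ n).map g ≫ v n
  have h₀ : f ≫ ψ = 0 := eq_zero_of_homology_eq_zero hY hd hK _ fun n => by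
    rw [Functor.map_comp, hψ, ← Category.assoc,
      homologyFunctor_map_comp_eq_zero hT.comp_eq_zero, zero_comp]
  obtain ⟨φ, rfl⟩ := hT.exists_desc ψ h₀
  refine ⟨φ, fun n => ?_⟩
  have : Epi ((homologyFunctor _ n).map g) := (hT.shortExact n).epi_g
  rw [← cancel_epi ((homologyFunctor _ n).map g), ← hψ, Functor.map_comp]

lemma GPHomology.exists_right [HasExt.{w} (ModuleCat.{u} A)]
    {X : DerivedCategory (ModuleCat.{u} A)} (hX : GPHomology A X) :
    ∃ Y, GPHomology A Y ∧ ProjectiveGhost X Y := by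
  choose N hN hXN using fun n => (hX n).exists_right
  choose P f g w hS hP _ using fun n => (hXN n).exists
  let e (n : ℤ) : (homologyFunctor _ n).obj (Q.obj (grComplex P)) ≅ P n :=
    homologyQIsoOfZeroD _ (grComplex_d P) n
  obtain ⟨i, hi⟩ := hX.exists_hom (grComplex_d P) (fun n => gpPerp_of_projective (hP n))
    fun n => f n ≫ (e n).inv
  obtain ⟨Y, q, h, hT⟩ := distinguished_cocone_triangle i
  have hgh : GhostTriangle i q h := ghostTriangle_of_mono hT fun n => by
    have : Mono (f n) := (hS n).mono_f
    rw [hi]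
    exact mono_comp _ _
  refine ⟨Y, fun n => ?_, _, memP1_grComplex hP, i, q, h, hgh⟩
  obtain ⟨a⟩ := nonempty_iso_of_shortExact_of_mono (hgh.shortExact n) (hS n) (e n)
    (by rw [hi]; simp)
  exact (hN n).of_iso a.symm

/-- Applying `Hom(-, P)` to `Y ⟶ E ⟶ X` gives a short exact sequence for all `P` in the
projective class. -/
def HomExact {X Y E : DerivedCategory (ModuleCat.{u} A)} (f : Y ⟶ E) (g : E ⟶ X) : Prop :=
  ∀ P : DerivedCategory (ModuleCat.{u} A), memP1 P →
    Function.Injective (fun φ : X ⟶ P => g ≫ φ) ∧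
    Function.Surjective (fun φ : E ⟶ P => f ≫ φ) ∧
    Function.Exact (fun φ : X ⟶ P => g ≫ φ) (fun φ : E ⟶ P => f ≫ φ)

lemma GhostTriangle.homExact [HasExt.{w} (ModuleCat.{u} A)]
    {X Y E : DerivedCategory (ModuleCat.{u} A)} (hX : GPHomology A X) (hY : GPHomology A Y)
    (hE : memP1 E) {f : Y ⟶ E} {g : E ⟶ X} {h : X ⟶ Y⟦(1:ℤ)⟧} (hT : GhostTriangle f g h) :
    HomExact f g := by
  refine fun P hP => ⟨fun φ ψ hφ => ?_, fun φ => ?_, fun φ => ⟨fun hφ => ?_, ?_⟩⟩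
  · rw [← sub_eq_zero]
    refine hP.eq_zero_of_homology_eq_zero hX _ fun n => ?_
    have : Epi ((homologyFunctor _ n).map g) := (hT.shortExact n).epi_g
    rw [← cancel_epi ((homologyFunctor _ n).map g), ← Functor.map_comp, Preadditive.comp_sub,
      sub_eq_zero.2 hφ, Functor.map_zero, comp_zero]
  · choose c hc using fun n => (gpPerp_of_projective.{w} (hP.projective_homology n)).exists_extension
      (hT.shortExact n) (hX n) ((homologyFunctor _ n).map φ)
    obtain ⟨ψ, hψ⟩ := hE.exists_hom c
    refine ⟨ψ, sub_eq_zero.1 (hP.eq_zero_of_homology_eq_zero hY _ fun n => ?_)⟩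
    rw [Functor.map_sub, Functor.map_comp, hψ, sub_eq_zero]
    exact hc n
  · obtain ⟨ψ, rfl⟩ := hT.exists_desc φ hφ
    exact ⟨ψ, rfl⟩
  · rintro ⟨ψ, rfl⟩
    dsimp
    rw [← Category.assoc, hT.comp_eq_zero, zero_comp]

end Triangles

section Resolutions

variable {A : Type u} [Ring A] [HasDerivedCategory.{w} (ModuleCat.{u} A)]

lemma GPHomology.of_iso {X Y : DerivedCategory (ModuleCat.{u} A)} (e : X ≅ Y)
    (hX : GPHomology A X) : GPHomology A Y :=
  fun n => (hX n).of_iso ((homologyFunctor _ n).mapIso e)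

lemma GPHomology.exists_resolution [HasExt.{w} (ModuleCat.{u} A)]
    {X : DerivedCategory (ModuleCat.{u} A)} (hX : GPHomology A X) :
    ∃ Xs : ℤ → DerivedCategory (ModuleCat.{u} A), Nonempty (Xs 0 ≅ X) ∧
      ∀ t : ℤ, ∃ (E : DerivedCategory (ModuleCat.{u} A)) (_ : memP1 E)
        (f : Xs (t + 1) ⟶ E) (g : E ⟶ Xs t) (h : Xs t ⟶ (Xs (t + 1))⟦(1:ℤ)⟧),
        GhostTriangle f g h ∧ HomExact f g := by
  obtain ⟨s, h0, hs⟩ := exists_int_chain (α := { X // GPHomology A X })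
    (fun X Y => ProjectiveGhost Y.1 X.1)
    (fun Y => by
      obtain ⟨X, hX, h⟩ := Y.2.exists_right
      exact ⟨⟨X, hX⟩, h⟩)
    (fun X => by
      obtain ⟨Y, hY, h⟩ := X.2.exists_left
      exact ⟨⟨Y, hY⟩, h⟩) ⟨X, hX⟩
  refine ⟨fun t => (s t).1, ⟨eqToIso (congrArg Subtype.val h0)⟩, fun t => ?_⟩
  obtain ⟨E, hE, f, g, h, hT⟩ := hs t
  exact ⟨E, hE, f, g, h, hT, hT.homExact (s t).2 (s (t + 1)).2 hE⟩

lemma exists_extension_of_homExact [HasExt.{w} (ModuleCat.{u} A)]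
    {X₀ X₁ X₂ E₀ E₁ E₂ : DerivedCategory (ModuleCat.{u} A)}
    {f₀ : X₁ ⟶ E₀} {g₀ : E₀ ⟶ X₀} {f₁ : X₂ ⟶ E₁} {g₁ : E₁ ⟶ X₁}
    {h₁ : X₁ ⟶ X₂⟦(1:ℤ)⟧} {X₃ : DerivedCategory (ModuleCat.{u} A)} {f₂ : X₃ ⟶ E₂} {g₂ : E₂ ⟶ X₂}
    (hE₁ : memP1 E₁) (hE₂ : memP1 E₂)
    (h : HomExact f₀ g₀) (hT : GhostTriangle f₁ g₁ h₁) (h' : HomExact f₂ g₂)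
    {P : ModuleCat.{u} A} (hP : Projective P) (n : ℤ) (a : (homologyFunctor _ n).obj X₁ ⟶ P) :
    ∃ b : (homologyFunctor _ n).obj E₀ ⟶ P, (homologyFunctor _ n).map f₀ ≫ b = a := by
  let C : CochainComplex (ModuleCat.{u} A) ℤ := grComplex fun _ => P
  let e (m : ℤ) : (homologyFunctor _ m).obj (Q.obj C) ≅ P :=
    homologyQIsoOfZeroD C (grComplex_d _) m
  have hC : memP1 (Q.obj C) := memP1_grComplex fun _ => hP
  let v : ∀ m, (homologyFunctor _ m).obj X₁ ⟶ (homologyFunctor _ m).obj (Q.obj C) :=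
    Function.update (fun _ => 0) n (a ≫ (e n).inv)
  obtain ⟨ψ, hψ⟩ := hE₁.exists_hom fun m => (homologyFunctor _ m).map g₁ ≫ v m
  have h₀ : g₂ ≫ f₁ ≫ ψ = 0 :=
    hC.eq_zero_of_homology_eq_zero hE₂.gpHomology _ fun m => by
      rw [Functor.map_comp, Functor.map_comp, hψ,
        reassoc_of% homologyFunctor_map_comp_eq_zero hT.comp_eq_zero m, zero_comp, comp_zero]
  obtain ⟨φ, rfl⟩ := hT.exists_desc ψ ((h' _ hC).1 (h₀.trans comp_zero.symm))
  obtain ⟨θ, rfl⟩ := (h _ hC).2.1 φ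
  refine ⟨(homologyFunctor _ n).map θ ≫ (e n).hom, ?_⟩
  have : Epi ((homologyFunctor _ n).map g₁) := (hT.shortExact n).epi_g
  have h₂ : (homologyFunctor _ n).map (f₀ ≫ θ) = v n := by
    rw [← cancel_epi ((homologyFunctor _ n).map g₁), ← hψ, ← Functor.map_comp]
  rw [← Functor.map_comp_assoc, h₂]
  simp [v]

lemma gpHomology_of_resolution [HasExt.{w} (ModuleCat.{u} A)]
    {Xs : ℤ → DerivedCategory (ModuleCat.{u} A)}
    (H : ∀ t : ℤ, ∃ (E : DerivedCategory (ModuleCat.{u} A)) (_ : memP1 E)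
      (f : Xs (t + 1) ⟶ E) (g : E ⟶ Xs t) (h : Xs t ⟶ (Xs (t + 1))⟦(1:ℤ)⟧),
      GhostTriangle f g h ∧ HomExact f g) (t : ℤ) : GPHomology A (Xs t) := by
  choose E hE f g h hT hfg using H
  have step (n t : ℤ) : GPStep ((homologyFunctor _ n).obj (Xs (t + 1)))
      ((homologyFunctor _ n).obj (Xs t)) :=
    GPStep.mk _ _ _ ((hT t).shortExact n) ((hE t).projective_homology n) fun P hP a =>
      exists_extension_of_homExact (hE _) (hE _) (hfg t) (hT _) (hfg _) hP n a
  intro n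
  refine isGorensteinProjective_of_closed
    (fun M => ∃ t, M = (homologyFunctor _ n).obj (Xs t)) ?_ ?_ ⟨t, rfl⟩
  · rintro _ ⟨t, rfl⟩
    exact ⟨_, ⟨t + 1, rfl⟩, step n t⟩
  · rintro _ ⟨t, rfl⟩
    obtain ⟨t, rfl⟩ : ∃ r, t = r + 1 := ⟨t - 1, by ring⟩
    exact ⟨_, ⟨t, rfl⟩, step n t⟩

lemma gammaMap_bijective [HasExt.{w} (ModuleCat.{u} A)]
    {X : DerivedCategory (ModuleCat.{u} A)} (hX : GPHomology A X) {N : ModuleCat.{u} A}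
    (hN : GPPerp.{w} N) (s : ℤ) : Function.Bijective (gammaMap X N s) := by
  let K : CochainComplex (ModuleCat.{u} A) ℤ :=
    ((HomologicalComplex.single _ (ComplexShape.up ℤ) 0).obj N)⟦s⟧
  have hd : ∀ i j, K.d i j = 0 := single_shift_d N s
  have hz (n : ℤ) (hn : n ≠ -s) : IsZero (K.X n) :=
    HomologicalComplex.isZero_single_obj_X (ComplexShape.up ℤ) 0 N (n + s) (by lia)
  have hK (n : ℤ) : GPPerp.{w} (K.X n) := by
    by_cases hn : n = -s
    · exact hN.of_iso
        (HomologicalComplex.singleObjXIsoOfEq (ComplexShape.up ℤ) 0 N (n + s) (by lia)).symm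
    · exact gpPerp_of_projective (hz n hn).projective
  have hzh (n : ℤ) (hn : n ≠ -s) : IsZero ((homologyFunctor (ModuleCat.{u} A) n).obj (Q.obj K)) :=
    (hz n hn).of_iso (homologyQIsoOfZeroD K hd n)
  let e : (stalk N)⟦s⟧ ≅ Q.obj K := ((Q.commShiftIso s).app _).symm
  let c : (homologyFunctor _ (-s)).obj ((stalk N)⟦s⟧) ≅ N :=
    shiftHomologyIso (stalk N) s (-s) 0 (by ring) ≪≫ stalkHomologyIso N
  have hγ (f : X ⟶ (stalk N)⟦s⟧) :
      gammaMap X N s f = (homologyFunctor _ (-s)).map f ≫ c.hom := rfl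
  refine ⟨fun f f' hf => ?_, fun v => ?_⟩
  · rw [hγ, hγ, cancel_mono] at hf
    have : (f - f') ≫ e.hom = 0 := eq_zero_of_homology_eq_zero hX hd hK _ fun n => by
      by_cases hn : n = -s
      · subst hn
        rw [Functor.map_comp, Functor.map_sub, hf, sub_self, zero_comp]
      · exact (hzh n hn).eq_of_tgt _ _
    rw [← sub_eq_zero, ← cancel_mono e.hom, this, zero_comp]
  · obtain ⟨φ, hφ⟩ := hX.exists_hom hd hK (Function.update (fun _ => 0) (-s)
      (v ≫ c.inv ≫ (homologyFunctor _ (-s)).map e.hom))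
    refine ⟨φ ≫ e.inv, ?_⟩
    rw [hγ, Functor.map_comp, hφ, Function.update_self]
    simp

end Resolutions

theorem stmt5 [HasExt.{w} (ModuleCat.{u} R)]
    (X : DerivedCategory (ModuleCat.{u} R)) :
    (∃ Xs : ℤ → DerivedCategory (ModuleCat.{u} R),
      Nonempty (Xs 0 ≅ X) ∧
      ∀ t : ℤ, ∃ (Pt : DerivedCategory (ModuleCat.{u} R)) (_ : memP1 Pt)
        (f : Xs (t+1) ⟶ Pt) (g : Pt ⟶ Xs t) (h : Xs t ⟶ (Xs (t+1))⟦(1:ℤ)⟧),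
        GhostTriangle f g h ∧
        ∀ P : DerivedCategory (ModuleCat.{u} R), memP1 P →
          Function.Injective (fun φ : Xs t ⟶ P => g ≫ φ) ∧
          Function.Surjective (fun φ : Pt ⟶ P => f ≫ φ) ∧
          Function.Exact (fun φ : Xs t ⟶ P => g ≫ φ) (fun φ : Pt ⟶ P => f ≫ φ)) ↔
    ((∀ s : ℤ, IsGorensteinProjective ((homologyFunctor (ModuleCat.{u} R) (-s)).obj X)) ∧
      ∀ N : ModuleCat.{u} R,
        (∀ G : ModuleCat.{u} R, IsGorensteinProjective G → Ext1Zero G N) →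
        ∀ s : ℤ, Function.Bijective (gammaMap X N s)) := by
  constructor
  · rintro ⟨Xs, ⟨e⟩, H⟩
    have hX : GPHomology R X := (gpHomology_of_resolution H 0).of_iso e
    exact ⟨fun s => hX _, fun N hN s => gammaMap_bijective hX hN s⟩
  · rintro ⟨hX, -⟩
    have : GPHomology R X := fun n => by simpa using hX (-n)
    exact this.exists_resolution
end
end

section
/- Let R be an associative ring with identity and let 0 → X → Y → Z → 0 be a short exact sequence of cochain complexes of left R-modules (i.e., 0 → X^s → Y^s → Z^s → 0 is exact for every s ∈ ℤ). Then the induced sequence 0 → Z^s(X) → Z^s(Y) → Z^s(Z) → 0 of cycle modules is exact for all s ∈ ℤ if and only if the induced sequence 0 → H^s(X) → H^s(Y) → H^s(Z) → 0 of cohomology modules is exact for all s ∈ ℤ. (Lemma 1.2, equivalence (1) ⟺ (3).) -/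
open CategoryTheory Limits DerivedCategory Pretriangulated

noncomputable section

universe w u

variable {R : Type u} [Ring R]

namespace HomologicalComplex

variable {C ι : Type*} [Category* C] {c : ComplexShape ι}

lemma epi_homologyMap_of_epi_cyclesMap [Preadditive C] {K L : HomologicalComplex C c} (f : K ⟶ L)
    (i : ι) [K.HasHomology i] [L.HasHomology i] [Epi (cyclesMap f i)] :
    Epi (homologyMap f i) := by
  have : Epi (K.homologyπ i ≫ homologyMap f i) := by
    rw [homologyπ_naturality]
    infer_instance
  exact epi_of_epi (K.homologyπ i) _

lemma toCycles_cyclesMap [HasZeroMorphisms C] {K L : HomologicalComplex C c} (f : K ⟶ L)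
    (i j : ι) [K.HasHomology j] [L.HasHomology j] :
    K.toCycles i j ≫ cyclesMap f j = f.f i ≫ L.toCycles i j := by
  simp [← cancel_mono (L.iCycles j)]

lemma epi_cyclesMap_of_epi_homologyMap [Preadditive C] {K L : HomologicalComplex C c} (f : K ⟶ L)
    (i j : ι) (hij : c.prev j = i) [K.HasHomology j] [L.HasHomology j]
    [Epi (f.f i)] [Epi (homologyMap f j)] :
    Epi (cyclesMap f j) := by
  refine Preadditive.epi_of_cancel_zero _ fun {A} k hk => ?_
  have hk' : L.toCycles i j ≫ k = 0 := by
    rw [← cancel_epi (f.f i), ← Category.assoc, ← toCycles_cyclesMap, Category.assoc, hk,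
      comp_zero, comp_zero]
  obtain ⟨l, hl⟩ := CokernelCofork.IsColimit.desc' (L.homologyIsCokernel i j hij) k hk'
  dsimp at hl
  have : l = 0 := by
    rw [← cancel_epi (homologyMap f j), ← cancel_epi (K.homologyπ j),
      homologyπ_naturality_assoc, hl, hk, comp_zero, comp_zero]
  rw [← hl, this, comp_zero]

end HomologicalComplex

lemma CategoryTheory.ShortComplex.ShortExact.mono_homologyMap_of_epi_homologyMap
    {C ι : Type*} [Category* C] [Abelian C] {c : ComplexShape ι}
    {S : ShortComplex (HomologicalComplex C c)} (hS : S.ShortExact) (i j : ι) (hij : c.Rel i j)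
    [Epi (HomologicalComplex.homologyMap S.g i)] :
    Mono (HomologicalComplex.homologyMap S.f j) := by
  refine (hS.homology_exact₁ i j hij).mono_g ?_
  rw [← cancel_epi (HomologicalComplex.homologyMap S.g i)]
  simp

theorem stmt12
    (X Y W : CochainComplex (ModuleCat.{u} R) ℤ) (φ : X ⟶ Y) (ψ : Y ⟶ W)
    (hses : ∀ s : ℤ, Function.Injective (φ.f s) ∧ Function.Surjective (ψ.f s) ∧
      Function.Exact (φ.f s) (ψ.f s)) :
    (∀ s : ℤ,
      Function.Injective (HomologicalComplex.cyclesMap φ s) ∧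
      Function.Surjective (HomologicalComplex.cyclesMap ψ s) ∧
      Function.Exact (HomologicalComplex.cyclesMap φ s) (HomologicalComplex.cyclesMap ψ s)) ↔
    (∀ s : ℤ,
      Function.Injective (HomologicalComplex.homologyMap φ s) ∧
      Function.Surjective (HomologicalComplex.homologyMap ψ s) ∧
      Function.Exact (HomologicalComplex.homologyMap φ s) (HomologicalComplex.homologyMap ψ s)) := by
  have hmono : ∀ s, Mono (φ.f s) := fun s => (ModuleCat.mono_iff_injective _).2 (hses s).1
  have hepi : ∀ s, Epi (ψ.f s) := fun s => (ModuleCat.epi_iff_surjective _).2 (hses s).2.1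
  have hφψ : φ ≫ ψ = 0 := by
    ext s x
    exact (hses s).2.2.apply_apply_eq_zero x
  let S : ShortComplex (CochainComplex (ModuleCat.{u} R) ℤ) := ShortComplex.mk φ ψ hφψ
  have hS : S.ShortExact := HomologicalComplex.shortExact_of_degreewise_shortExact S fun s =>
    { exact := (ShortComplex.ShortExact.moduleCat_exact_iff_function_exact _).2 (hses s).2.2
      mono_f := hmono s
      epi_g := hepi s }
  have : Mono S.f := hS.mono_f
  constructor
  · intro h s
    have hH : ∀ s, Epi (HomologicalComplex.homologyMap ψ s) := fun s =>
      have : Epi (HomologicalComplex.cyclesMap ψ s) :=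
        (ModuleCat.epi_iff_surjective _).2 (h s).2.1
      HomologicalComplex.epi_homologyMap_of_epi_cyclesMap ψ s
    have : Epi (HomologicalComplex.homologyMap S.g (s - 1)) := hH _
    exact ⟨(ModuleCat.mono_iff_injective _).1
        (hS.mono_homologyMap_of_epi_homologyMap (s - 1) s (by simp)),
      (ModuleCat.epi_iff_surjective _).1 (hH s),
      (ShortComplex.ShortExact.moduleCat_exact_iff_function_exact _).1 (hS.homology_exact₂ s)⟩
  · intro h s
    have : Epi (HomologicalComplex.homologyMap ψ s) :=
      (ModuleCat.epi_iff_surjective _).2 (h s).2.1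
    exact ⟨(ModuleCat.mono_iff_injective _).1
        (inferInstanceAs (Mono (HomologicalComplex.cyclesMap S.f s))),
      (ModuleCat.epi_iff_surjective _).1
        (HomologicalComplex.epi_cyclesMap_of_epi_homologyMap ψ _ s rfl),
      (ShortComplex.ShortExact.moduleCat_exact_iff_function_exact _).1
        (HomologicalComplex.cycles_left_exact S hS.exact s)⟩
end
end

section
/- Let R be an associative ring with identity and let 0 → X → Y → Z → 0 be a short exact sequence of cochain complexes of left R-modules (i.e., 0 → X^s → Y^s → Z^s → 0 is exact for every s ∈ ℤ). Then the induced sequence 0 → C^s(X) → C^s(Y) → C^s(Z) → 0 of cokernel modules is exact for all s ∈ ℤ if and only if the induced sequence 0 → H^s(X) → H^s(Y) → H^s(Z) → 0 of cohomology modules is exact for all s ∈ ℤ. (Lemma 1.2, equivalence (2) ⟺ (3).) -/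
open CategoryTheory Limits DerivedCategory Pretriangulated

noncomputable section

universe w u

variable {R : Type u} [Ring R]

section Abelian

variable {C ι : Type*} [Category* C] [Abelian C] {c : ComplexShape ι}

theorem mono_homologyMap_of_mono_opcyclesMap {K L : HomologicalComplex C c} (φ : K ⟶ L) (i : ι)
    [Mono (HomologicalComplex.opcyclesMap φ i)] : Mono (HomologicalComplex.homologyMap φ i) := by
  have : Mono (HomologicalComplex.homologyMap φ i ≫ L.homologyι i) := by
    rw [HomologicalComplex.homologyι_naturality]
    infer_instance
  exact mono_of_mono _ (L.homologyι i)

theorem mono_opcyclesMap_of_mono_homologyMap {K L : HomologicalComplex C c} (φ : K ⟶ L) (i : ι)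
    [Mono (φ.f (c.next i))] [Mono (HomologicalComplex.homologyMap φ i)] :
    Mono (HomologicalComplex.opcyclesMap φ i) := by
  refine Preadditive.mono_of_cancel_zero _ fun {A} x hx => ?_
  have h : x ≫ K.fromOpcycles i (c.next i) = 0 := by
    have comm : HomologicalComplex.opcyclesMap φ i ≫ L.fromOpcycles i (c.next i) =
        K.fromOpcycles i (c.next i) ≫ φ.f (c.next i) := by
      simp [← cancel_epi (K.pOpcycles i)]
    rw [← cancel_mono (φ.f (c.next i)), Category.assoc, ← comm, reassoc_of% hx, zero_comp,
      zero_comp]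
  obtain ⟨y, hy⟩ := KernelFork.IsLimit.lift' (K.homologyIsKernel i _ rfl) x h
  replace hy : y ≫ K.homologyι i = x := hy
  have hy₀ : y = 0 := by
    rw [← cancel_mono (HomologicalComplex.homologyMap φ i), ← cancel_mono (L.homologyι i),
      Category.assoc, HomologicalComplex.homologyι_naturality, reassoc_of% hy, hx, zero_comp,
      zero_comp]
  rw [← hy, hy₀, zero_comp]

theorem epi_homologyMap_of_mono_homologyMap {S : ShortComplex (HomologicalComplex C c)}
    (hS : S.ShortExact) (i j : ι) (hij : c.Rel i j)
    [Mono (HomologicalComplex.homologyMap S.f j)] :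
    Epi (HomologicalComplex.homologyMap S.g i) := by
  refine (hS.homology_exact₃ i j hij).epi_f ?_
  exact zero_of_comp_mono (HomologicalComplex.homologyMap S.f j) (hS.δ_comp i j hij)

end Abelian

theorem function_exact_of_exact {S : ShortComplex (ModuleCat.{u} R)} (hS : S.Exact) :
    Function.Exact S.f S.g :=
  (ShortComplex.ShortExact.moduleCat_exact_iff_function_exact S).1 hS

theorem shortExact_of_forall_injective_surjective_exact
    {S : ShortComplex (CochainComplex (ModuleCat.{u} R) ℤ)}
    (h : ∀ s : ℤ, Function.Injective (S.f.f s) ∧ Function.Surjective (S.g.f s) ∧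
      Function.Exact (S.f.f s) (S.g.f s)) : S.ShortExact := by
  refine HomologicalComplex.shortExact_of_degreewise_shortExact S fun s => ?_
  obtain ⟨hf, hg, hfg⟩ := h s
  exact
    { exact := (ShortComplex.ShortExact.moduleCat_exact_iff_function_exact _).2 hfg
      mono_f := (ModuleCat.mono_iff_injective _).2 hf
      epi_g := (ModuleCat.epi_iff_surjective _).2 hg }

theorem stmt13
    (X Y W : CochainComplex (ModuleCat.{u} R) ℤ) (φ : X ⟶ Y) (ψ : Y ⟶ W)
    (hses : ∀ s : ℤ, Function.Injective (φ.f s) ∧ Function.Surjective (ψ.f s) ∧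
      Function.Exact (φ.f s) (ψ.f s)) :
    (∀ s : ℤ,
      Function.Injective (HomologicalComplex.opcyclesMap φ s) ∧
      Function.Surjective (HomologicalComplex.opcyclesMap ψ s) ∧
      Function.Exact (HomologicalComplex.opcyclesMap φ s) (HomologicalComplex.opcyclesMap ψ s)) ↔
    (∀ s : ℤ,
      Function.Injective (HomologicalComplex.homologyMap φ s) ∧
      Function.Surjective (HomologicalComplex.homologyMap ψ s) ∧
      Function.Exact (HomologicalComplex.homologyMap φ s) (HomologicalComplex.homologyMap ψ s)) := by
  have zero : φ ≫ ψ = 0 := by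
    ext s x
    exact (hses s).2.2.apply_apply_eq_zero x
  let S := ShortComplex.mk φ ψ zero
  have hS : S.ShortExact := shortExact_of_forall_injective_surjective_exact hses
  have hφ (s : ℤ) : Mono (φ.f s) := (ModuleCat.mono_iff_injective _).2 (hses s).1
  have : Epi S.g := hS.epi_g
  constructor
  · intro h s
    have mono (t : ℤ) : Mono (HomologicalComplex.homologyMap φ t) := by
      have : Mono (HomologicalComplex.opcyclesMap φ t) :=
        (ModuleCat.mono_iff_injective _).2 (h t).1
      exact mono_homologyMap_of_mono_opcyclesMap φ t
    have : Mono (HomologicalComplex.homologyMap S.f (s + 1)) := mono (s + 1)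
    exact ⟨(ModuleCat.mono_iff_injective _).1 (mono s),
      (ModuleCat.epi_iff_surjective _).1
        (epi_homologyMap_of_mono_homologyMap hS s (s + 1) (by simp)),
      function_exact_of_exact (hS.homology_exact₂ s)⟩
  · intro h s
    have : Mono (HomologicalComplex.homologyMap φ s) := (ModuleCat.mono_iff_injective _).2 (h s).1
    exact ⟨(ModuleCat.mono_iff_injective _).1 (mono_opcyclesMap_of_mono_homologyMap φ s),
      (ModuleCat.epi_iff_surjective _).1 inferInstance,
      function_exact_of_exact (HomologicalComplex.opcycles_right_exact S hS.exact s)⟩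
end
end

section
/- Let R be an associative ring with identity, X a cochain complex of left R-modules, M a left R-module, and s ∈ ℤ. Assume Ext^i_R(X^n, M) = 0 for all n ∈ ℤ and all i ≥ 1, and assume Ext^1_R(C^{s+1}(X), M) = 0 and Ext^2_R(C^{s+1}(X), M) = 0. Then the canonical map H^{-s}(Hom_R(X,M)) → Hom_R(H^s(X), M) is bijective, where Hom_R(X,M) is the Hom complex of X into the stalk complex on M (its degree −s cocycles are the maps f : X^s → M with f ∘ d_X^{s-1} = 0), and the canonical map sends the class of such a cocycle f to the homomorphism H^s(X) → M induced by the restriction of f to Z^s(X). (Consequence of the long exact sequence (1.1) of Lemma 1.1.) -/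
open CategoryTheory Limits DerivedCategory Pretriangulated

noncomputable section

universe w u

variable {R : Type u} [Ring R]

section

variable {C : Type*} [Category C] [Abelian C]

lemma CategoryTheory.ShortComplex.ShortExact.exists_extension [HasExt.{w} C]
    {S : ShortComplex C} (hS : S.ShortExact) {M : C}
    (h : Subsingleton (Abelian.Ext S.X₃ M 1)) (φ : S.X₁ ⟶ M) :
    ∃ ψ : S.X₂ ⟶ M, S.f ≫ ψ = φ := by
  obtain ⟨x, hx⟩ := Abelian.Ext.contravariant_sequence_exact₁ hS (Y := M)
    (Abelian.Ext.mk₀ φ) (n₁ := 1) rfl (Subsingleton.elim _ _)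
  obtain ⟨ψ, rfl⟩ := (Abelian.Ext.mk₀_bijective _ _).2 x
  exact ⟨ψ, (Abelian.Ext.mk₀_bijective _ _).1 (by simpa using hx)⟩

lemma CategoryTheory.ShortComplex.ShortExact.subsingleton_ext_X₁ [HasExt.{w} C]
    {S : ShortComplex C} (hS : S.ShortExact) {M : C}
    (n : ℕ) (h₂ : Subsingleton (Abelian.Ext S.X₂ M n))
    (h₃ : Subsingleton (Abelian.Ext S.X₃ M (1 + n))) :
    Subsingleton (Abelian.Ext S.X₁ M n) := by
  refine subsingleton_of_forall_eq 0 fun x => ?_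
  obtain ⟨y, rfl⟩ := Abelian.Ext.contravariant_sequence_exact₁ hS _ x rfl (Subsingleton.elim _ _)
  rw [Subsingleton.elim y 0, Abelian.Ext.comp_zero]

variable (X : CochainComplex C ℤ) (s : ℤ)

/-- The short exact sequence `0 ⟶ H^s(X) ⟶ C^s(X) ⟶ B^{s+1}(X) ⟶ 0`. -/
def CochainComplex.homologyOpcyclesBoundaries : ShortComplex C :=
  .mk (X.homologyι s) (factorThruImage (X.fromOpcycles s (s + 1))) (by
    rw [← cancel_mono (image.ι _)]
    simp)

lemma CochainComplex.homologyOpcyclesBoundaries_shortExact :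
    (X.homologyOpcyclesBoundaries s).ShortExact where
  exact := by
    let φ : X.homologyOpcyclesBoundaries s ⟶
        .mk (X.homologyι s) (X.fromOpcycles s (s + 1)) (by simp) :=
      { τ₁ := 𝟙 _, τ₂ := 𝟙 _, τ₃ := image.ι _
        comm₁₂ := by simp [homologyOpcyclesBoundaries]
        comm₂₃ := by simp [homologyOpcyclesBoundaries] }
    have : Epi φ.τ₁ := inferInstanceAs (Epi (𝟙 _))
    have : IsIso φ.τ₂ := inferInstanceAs (IsIso (𝟙 _))
    have : Mono φ.τ₃ := inferInstanceAs (Mono (image.ι _))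
    rw [ShortComplex.exact_iff_of_epi_of_isIso_of_mono φ]
    exact ShortComplex.exact_of_f_is_kernel _ (X.homologyIsKernel s (s + 1) (by simp))
  mono_f := inferInstanceAs (Mono (X.homologyι s))
  epi_g := inferInstanceAs (Epi (factorThruImage (X.fromOpcycles s (s + 1))))

/-- The short exact sequence `0 ⟶ B^{s+1}(X) ⟶ X^{s+1} ⟶ C^{s+1}(X) ⟶ 0`. -/
def CochainComplex.boundariesOpcycles : ShortComplex C :=
  .mk (image.ι (X.fromOpcycles s (s + 1))) (X.pOpcycles (s + 1)) (by
    rw [← cancel_epi (factorThruImage _), ← cancel_epi (X.pOpcycles s)]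
    simp)

lemma CochainComplex.boundariesOpcycles_shortExact :
    (X.boundariesOpcycles s).ShortExact where
  exact := by
    let φ : .mk (X.d s (s + 1)) (X.pOpcycles (s + 1)) (by simp) ⟶ X.boundariesOpcycles s :=
      { τ₁ := X.pOpcycles s ≫ factorThruImage (X.fromOpcycles s (s + 1))
        τ₂ := 𝟙 _, τ₃ := 𝟙 _
        comm₁₂ := by simp [boundariesOpcycles]
        comm₂₃ := by simp [boundariesOpcycles] }
    have : Epi φ.τ₁ := inferInstanceAs
      (Epi (X.pOpcycles s ≫ factorThruImage (X.fromOpcycles s (s + 1))))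
    have : IsIso φ.τ₂ := inferInstanceAs (IsIso (𝟙 _))
    have : Mono φ.τ₃ := inferInstanceAs (Mono (𝟙 _))
    rw [← ShortComplex.exact_iff_of_epi_of_isIso_of_mono φ]
    exact ShortComplex.exact_of_g_is_cokernel _ (X.opcyclesIsCokernel s (s + 1) (by simp))
  mono_f := inferInstanceAs (Mono (image.ι (X.fromOpcycles s (s + 1))))
  epi_g := inferInstanceAs (Epi (X.pOpcycles (s + 1)))

end

theorem stmt14 [HasExt.{w} (ModuleCat.{u} R)]
    (X : CochainComplex (ModuleCat.{u} R) ℤ) (M : ModuleCat.{u} R) (s : ℤ)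
    (hcomp : ∀ (n : ℤ) (i : ℕ), 1 ≤ i → Subsingleton (Abelian.Ext (X.X n) M i))
    (h1 : Subsingleton (Abelian.Ext (X.opcycles (s+1)) M 1))
    (h2 : Subsingleton (Abelian.Ext (X.opcycles (s+1)) M 2)) :
    Function.Surjective
      (fun f : {f : X.X s ⟶ M // X.d (s-1) s ≫ f = 0} =>
        X.homologyι s ≫ X.descOpcycles f.1 (s-1) (CochainComplex.prev ℤ s) f.2) ∧
    ∀ f g : {f : X.X s ⟶ M // X.d (s-1) s ≫ f = 0},
      (X.homologyι s ≫ X.descOpcycles f.1 (s-1) (CochainComplex.prev ℤ s) f.2 =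
        X.homologyι s ≫ X.descOpcycles g.1 (s-1) (CochainComplex.prev ℤ s) g.2) ↔
      ∃ t : X.X (s+1) ⟶ M, f.1 = g.1 + X.d s (s+1) ≫ t := by
  have hB := X.boundariesOpcycles_shortExact s
  have hH := X.homologyOpcyclesBoundaries_shortExact s
  refine ⟨fun φ => ?_, fun f g => ⟨fun h => ?_, ?_⟩⟩
  · obtain ⟨ψ, hψ⟩ : ∃ ψ : X.opcycles s ⟶ M, X.homologyι s ≫ ψ = φ := hH.exists_extension
      (hB.subsingleton_ext_X₁ 1 (hcomp (s + 1) 1 le_rfl) h2) φ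
    refine ⟨⟨X.pOpcycles s ≫ ψ, by simp⟩, ?_⟩
    have : X.descOpcycles (X.pOpcycles s ≫ ψ) (s - 1) (CochainComplex.prev ℤ s) (by simp) = ψ := by
      rw [← cancel_epi (X.pOpcycles s), HomologicalComplex.p_descOpcycles]
    exact (congrArg (X.homologyι s ≫ ·) this).trans hψ
  · have := hH.epi_g
    obtain ⟨b, hb⟩ : ∃ b : image (X.fromOpcycles s (s + 1)) ⟶ M,
        factorThruImage _ ≫ b =
          X.descOpcycles f.1 (s - 1) (CochainComplex.prev ℤ s) f.2 -
            X.descOpcycles g.1 (s - 1) (CochainComplex.prev ℤ s) g.2 :=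
      ⟨_, hH.exact.g_desc _ ((Preadditive.comp_sub ..).trans (sub_eq_zero.2 h))⟩
    obtain ⟨t, ht⟩ : ∃ t : X.X (s + 1) ⟶ M, image.ι (X.fromOpcycles s (s + 1)) ≫ t = b :=
      hB.exists_extension h1 b
    refine ⟨t, ?_⟩
    rw [← sub_eq_iff_eq_add', ← X.p_fromOpcycles s (s + 1),
      ← image.fac (X.fromOpcycles s (s + 1)), Category.assoc, Category.assoc, ht, hb]
    simp
  · rintro ⟨t, ht⟩
    have : X.descOpcycles f.1 (s - 1) (CochainComplex.prev ℤ s) f.2 =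
        X.descOpcycles g.1 (s - 1) (CochainComplex.prev ℤ s) g.2 +
          X.fromOpcycles s (s + 1) ≫ t := by
      simp [← cancel_epi (X.pOpcycles s), ht]
    simp [this]
end
end

section
/- Let R be an associative ring with identity, X a cochain complex of left R-modules, L a left R-module, and s ∈ ℤ. Assume Ext^i_R(L, X^n) = 0 for all n ∈ ℤ and all i ≥ 1, and assume Ext^1_R(L, Z^{s-1}(X)) = 0 and Ext^2_R(L, Z^{s-1}(X)) = 0. Then the canonical map H^s(Hom_R(L,X)) → Hom_R(L, H^s(X)) is bijective, where Hom_R(L,X) is the cochain complex of abelian groups with degree-n component Hom_R(L, X^n) and differential given by postcomposition with d_X (its degree-s cocycles are the maps g : L → X^s with d_X^s ∘ g = 0, i.e., maps L → Z^s(X)), and the canonical map sends the class of such a cocycle g to the composition of g with the quotient map Z^s(X) → H^s(X). (Consequence of the long exact sequence (1.2) of Lemma 1.1.) -/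
open CategoryTheory Limits DerivedCategory Pretriangulated

noncomputable section

universe w u

variable {R : Type u} [Ring R]

section

variable {C : Type*} [Category C] [Abelian C]

namespace CategoryTheory.ShortComplex.ShortExact

variable [HasExt.{w} C] {S : ShortComplex C} (hS : S.ShortExact) {L : C}
include hS

lemma exists_lift_of_subsingleton_ext_one [Subsingleton (Abelian.Ext L S.X₁ 1)]
    (f : L ⟶ S.X₃) : ∃ g : L ⟶ S.X₂, g ≫ S.g = f := by
  obtain ⟨y, hy⟩ := Abelian.Ext.covariant_sequence_exact₃ L hS (Abelian.Ext.mk₀ f)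
    (zero_add 1) (Subsingleton.elim _ _)
  obtain ⟨g, rfl⟩ := (Abelian.Ext.mk₀_bijective L S.X₂).2 y
  exact ⟨g, (Abelian.Ext.mk₀_bijective L S.X₃).1 (by simpa using hy)⟩

lemma subsingleton_ext_X₃ (n : ℕ) [Subsingleton (Abelian.Ext L S.X₂ n)]
    [Subsingleton (Abelian.Ext L S.X₁ (n + 1))] : Subsingleton (Abelian.Ext L S.X₃ n) := by
  refine subsingleton_of_forall_eq 0 fun x => ?_
  obtain ⟨y, rfl⟩ := Abelian.Ext.covariant_sequence_exact₃ L hS x rfl (Subsingleton.elim _ _)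
  rw [Subsingleton.elim y 0, Abelian.Ext.zero_comp]

end CategoryTheory.ShortComplex.ShortExact

namespace HomologicalComplex

variable {ι : Type*} {c : ComplexShape ι} (K : HomologicalComplex C c) (i j : ι)

/-- The sequence `0 ⟶ Zⁱ ⟶ Kⁱ ⟶ Bʲ ⟶ 0`, where `Bʲ` is the image of `Kⁱ ⟶ Zʲ`. -/
abbrev cyclesBoundariesShortComplex : ShortComplex C :=
  ShortComplex.mk (K.iCycles i) (factorThruImage (K.toCycles i j))
    (by simp [← cancel_mono (image.ι (K.toCycles i j)), ← cancel_mono (K.iCycles j)])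

lemma cyclesBoundariesShortComplex_shortExact (hj : c.next i = j) :
    (K.cyclesBoundariesShortComplex i j).ShortExact where
  exact := by
    let φ : K.cyclesBoundariesShortComplex i j ⟶
        ShortComplex.mk (K.iCycles i) (K.d i j) (K.iCycles_d i j) :=
      { τ₁ := 𝟙 _
        τ₂ := 𝟙 _
        τ₃ := image.ι (K.toCycles i j) ≫ K.iCycles j }
    have : Epi φ.τ₁ := inferInstanceAs (Epi (𝟙 _))
    have : IsIso φ.τ₂ := inferInstanceAs (IsIso (𝟙 _))
    have : Mono φ.τ₃ := inferInstanceAs (Mono (image.ι (K.toCycles i j) ≫ K.iCycles j))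
    exact (ShortComplex.exact_iff_of_epi_of_isIso_of_mono φ).2
      (ShortComplex.exact_of_f_is_kernel _ (K.cyclesIsKernel i j hj))
  mono_f := inferInstanceAs (Mono (K.iCycles i))
  epi_g := inferInstanceAs (Epi (factorThruImage (K.toCycles i j)))

/-- The sequence `0 ⟶ Bʲ ⟶ Zʲ ⟶ Hʲ ⟶ 0`, where `Bʲ` is the image of `Kⁱ ⟶ Zʲ`. -/
abbrev boundariesCyclesShortComplex : ShortComplex C :=
  ShortComplex.mk (image.ι (K.toCycles i j)) (K.homologyπ j)
    (by simp [← cancel_epi (factorThruImage (K.toCycles i j))])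

lemma boundariesCyclesShortComplex_shortExact (hi : c.prev j = i) :
    (K.boundariesCyclesShortComplex i j).ShortExact where
  exact := by
    let φ : ShortComplex.mk (K.toCycles i j) (K.homologyπ j) (K.toCycles_comp_homologyπ i j) ⟶
        K.boundariesCyclesShortComplex i j :=
      { τ₁ := factorThruImage (K.toCycles i j)
        τ₂ := 𝟙 _
        τ₃ := 𝟙 _ }
    have : Epi φ.τ₁ := inferInstanceAs (Epi (factorThruImage (K.toCycles i j)))
    have : IsIso φ.τ₂ := inferInstanceAs (IsIso (𝟙 _))
    have : Mono φ.τ₃ := inferInstanceAs (Mono (𝟙 _))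
    exact (ShortComplex.exact_iff_of_epi_of_isIso_of_mono φ).1
      (ShortComplex.exact_of_g_is_cokernel _ (K.homologyIsCokernel i j hi))
  mono_f := inferInstanceAs (Mono (image.ι (K.toCycles i j)))
  epi_g := inferInstanceAs (Epi (K.homologyπ j))

end HomologicalComplex

end

theorem stmt15 [HasExt.{w} (ModuleCat.{u} R)]
    (X : CochainComplex (ModuleCat.{u} R) ℤ) (L : ModuleCat.{u} R) (s : ℤ)
    (hcomp : ∀ (n : ℤ) (i : ℕ), 1 ≤ i → Subsingleton (Abelian.Ext L (X.X n) i))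
    (h1 : Subsingleton (Abelian.Ext L (X.cycles (s-1)) 1))
    (h2 : Subsingleton (Abelian.Ext L (X.cycles (s-1)) 2)) :
    Function.Surjective
      (fun g : {g : L ⟶ X.X s // g ≫ X.d s (s+1) = 0} =>
        X.liftCycles g.1 (s+1) (CochainComplex.next ℤ s) g.2 ≫ X.homologyπ s) ∧
    ∀ f g : {g : L ⟶ X.X s // g ≫ X.d s (s+1) = 0},
      (X.liftCycles f.1 (s+1) (CochainComplex.next ℤ s) f.2 ≫ X.homologyπ s =
        X.liftCycles g.1 (s+1) (CochainComplex.next ℤ s) g.2 ≫ X.homologyπ s) ↔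
      ∃ t : L ⟶ X.X (s-1), f.1 = g.1 + t ≫ X.d (s-1) s := by
  have hB := X.cyclesBoundariesShortComplex_shortExact (s-1) s (by simp)
  have hH := X.boundariesCyclesShortComplex_shortExact (s-1) s (by simp)
  have := hcomp (s-1) 1 le_rfl
  have : Subsingleton (Abelian.Ext L (image (X.toCycles (s-1) s)) 1) :=
    hB.subsingleton_ext_X₃ 1
  refine ⟨fun h => ?_, fun f g => ⟨fun h => ?_, ?_⟩⟩
  · obtain ⟨z, hz⟩ := hH.exists_lift_of_subsingleton_ext_one h
    refine ⟨⟨z ≫ X.iCycles s, by simp⟩, ?_⟩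
    have hlift : X.liftCycles (z ≫ X.iCycles s) (s+1) (CochainComplex.next ℤ s) (by simp) = z :=
      (cancel_mono (X.iCycles s)).1 (X.liftCycles_i _ _ _ _)
    exact (congrArg (· ≫ X.homologyπ s) hlift).trans hz
  · have hfg : (X.liftCycles f.1 (s+1) (CochainComplex.next ℤ s) f.2 -
        X.liftCycles g.1 (s+1) (CochainComplex.next ℤ s) g.2) ≫ X.homologyπ s = 0 := by
      rw [Preadditive.sub_comp, h, sub_self]
    have := hH.mono_f
    let b := hH.exact.lift _ hfg
    have hb : b ≫ image.ι (X.toCycles (s-1) s) = _ := hH.exact.lift_f _ hfg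
    obtain ⟨t, ht⟩ := hB.exists_lift_of_subsingleton_ext_one b
    refine ⟨t, ?_⟩
    have ht' : t ≫ X.toCycles (s-1) s = X.liftCycles f.1 (s+1) (CochainComplex.next ℤ s) f.2 -
        X.liftCycles g.1 (s+1) (CochainComplex.next ℤ s) g.2 := by
      rw [← image.fac (X.toCycles (s-1) s), reassoc_of% ht, hb]
    have htd : t ≫ X.d (s-1) s = f.1 - g.1 := by
      simpa [Preadditive.sub_comp] using congrArg (· ≫ X.iCycles s) ht'
    rw [htd, add_sub_cancel]
  · rintro ⟨t, ht⟩
    have hfg : X.liftCycles f.1 (s+1) (CochainComplex.next ℤ s) f.2 =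
        X.liftCycles g.1 (s+1) (CochainComplex.next ℤ s) g.2 + t ≫ X.toCycles (s-1) s := by
      simp [← cancel_mono (X.iCycles s), ht]
    simp [hfg]
end
end
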